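/- Let p be a prime with p ≥ 5 and k an even integer, and let K = Q(√-1). If f ∈ M_k^{(s)}(U_2(O_K), ν_k)_Q satisfies a_f([[m, α],[ᾱ, n]]) = 0 for all integers m, n and all α ∈ D_K^{-1} with 0 ≤ m ≤ (5k+8)/40, 0 ≤ n ≤ (15k+4)/120 and mn − N(α) ≥ 0, then f = 0 identically. -/

import Mathlib

open Complex Matrix
open scoped ComplexOrder

noncomputable section

/-- `√d_K` for an imaginary quadratic discriminant `d < 0`,
taken as `√|d| · i` in the upper half plane. -/
def sqrtD (d : ℤ) : ℂ := Real.sqrt (-d) * Complex.I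

/-- The ring of integers `O_K = ℤ[(d + √d)/2]` of the imaginary quadratic field of
discriminant `d`, viewed as a subset of `ℂ`. -/
def ringInt (d : ℤ) : Set ℂ :=
  {z | ∃ a b : ℤ, z = (a : ℂ) + (b : ℂ) * (((d : ℂ) + sqrtD d) / 2)}

/-- The inverse different `D_K⁻¹ = O_K / √d_K`. -/
def invDiff (d : ℤ) : Set ℂ := {z | sqrtD d * z ∈ ringInt d}

/-- The Hermitian upper half-space of degree 2:
`Z` with `(Z - ᵗZ̄)/(2i)` positive definite. -/
def HermitianUpperHalfSpace : Set (Matrix (Fin 2) (Fin 2) ℂ) :=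
  {Z | ((Z - Zᴴ).map (fun w => w / (2 * Complex.I))).PosDef}

/-- The lattice `Λ₂(K)`: Hermitian matrices with integral diagonal and
`√d_K ·`(off-diagonal entries) in `O_K`. -/
def LambdaH (d : ℤ) : Set (Matrix (Fin 2) (Fin 2) ℂ) :=
  {H | H.IsHermitian ∧ (∀ i, ∃ n : ℤ, H i i = (n : ℂ)) ∧
    ∀ i j, sqrtD d * H i j ∈ ringInt d}

/-- Semi-positive elements of `Λ₂(K)`, the index set of Fourier expansions. -/
def HermLattice (d : ℤ) : Set (Matrix (Fin 2) (Fin 2) ℂ) :=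
  {H | H ∈ LambdaH d ∧ H.PosSemidef}

/-- The symplectic-form matrix `J₂ = [[0, -1], [1, 0]]` (2×2 blocks). -/
def J2 : Matrix (Fin 2 ⊕ Fin 2) (Fin 2 ⊕ Fin 2) ℂ :=
  Matrix.fromBlocks 0 (-1) 1 0

/-- The Hermitian modular group `U₂(O_K)`:
matrices with entries in `O_K` satisfying `ᵗM̄ J₂ M = J₂`. -/
def HermitianModularGroup (d : ℤ) : Set (Matrix (Fin 2 ⊕ Fin 2) (Fin 2 ⊕ Fin 2) ℂ) :=
  {M | (∀ i j, M i j ∈ ringInt d) ∧ Mᴴ * J2 * M = J2}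

/-- The fractional-linear action `Z ↦ (AZ + B)(CZ + D)⁻¹`. -/
def matAct (M : Matrix (Fin 2 ⊕ Fin 2) (Fin 2 ⊕ Fin 2) ℂ)
    (Z : Matrix (Fin 2) (Fin 2) ℂ) : Matrix (Fin 2) (Fin 2) ℂ :=
  (M.toBlocks₁₁ * Z + M.toBlocks₁₂) * (M.toBlocks₂₁ * Z + M.toBlocks₂₂)⁻¹

/-- The character `ν_k`: `det^{k/2}` for `K = ℚ(√-1)` (i.e. `d = -4`, `k` even),
and `det^k` for `K = ℚ(√-3)` (i.e. `d = -3`). -/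
def nuChar (d k : ℤ) (M : Matrix (Fin 2 ⊕ Fin 2) (Fin 2 ⊕ Fin 2) ℂ) : ℂ :=
  if d = -4 then M.det ^ (k / 2) else M.det ^ k

/-- A Hermitian modular form of degree 2, weight `k` and character `ν_k` for `U₂(O_K)`,
bundled with its Fourier expansion over the semi-positive part of `Λ₂(K)`. -/
structure HermitianModularForm (d k : ℤ) where
  toFun : Matrix (Fin 2) (Fin 2) ℂ → ℂ
  coeff : Matrix (Fin 2) (Fin 2) ℂ → ℂ
  holo : DifferentiableOn ℂ (fun Z : Fin 2 → Fin 2 → ℂ => toFun (Matrix.of Z))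
    {Z | Matrix.of Z ∈ HermitianUpperHalfSpace}
  transform : ∀ M ∈ HermitianModularGroup d, ∀ Z ∈ HermitianUpperHalfSpace,
    toFun (matAct M Z) =
      nuChar d k M * (M.toBlocks₂₁ * Z + M.toBlocks₂₂).det ^ k * toFun Z
  coeff_supported : ∀ H, coeff H ≠ 0 → H ∈ HermLattice d
  expansion : ∀ Z ∈ HermitianUpperHalfSpace,
    HasSum (fun H : HermLattice d =>
      coeff H * Complex.exp (2 * Real.pi * Complex.I * ((H : Matrix (Fin 2) (Fin 2) ℂ) * Z).trace))
      (toFun Z)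

/-- A Hermitian modular form is symmetric if `f(ᵗZ) = f(Z)`. -/
def IsSymmetricHMF {d k : ℤ} (f : HermitianModularForm d k) : Prop :=
  ∀ Z ∈ HermitianUpperHalfSpace, f.toFun Zᵀ = f.toFun Z

/-- `z` is a `p`-integral rational number: `z = a/b` with `p ∤ b`. -/
def IsPIntegral (p : ℕ) (z : ℂ) : Prop :=
  ∃ a b : ℤ, ¬ (p : ℤ) ∣ b ∧ (b : ℂ) * z = (a : ℂ)

/-- `z ≡ w (mod p^l)` in the local ring `ℤ_(p)`, i.e. `(z - w)/p^l` is `p`-integral. -/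
def ModCongr (p l : ℕ) (z w : ℂ) : Prop :=
  IsPIntegral p ((z - w) / (p : ℂ) ^ l)


/-- The lexicographic order on `Λ₂(K)` used to define `ord_p`:
compare first `tr H`, then the `(1,1)`-entry `m`, then (for off-diagonal entry
`(a + b i)/2`) first `a`, then `b`. -/
def lexLt (H H' : Matrix (Fin 2) (Fin 2) ℂ) : Prop :=
  H.trace.re < H'.trace.re ∨
    (H.trace = H'.trace ∧
      ((H 0 0).re < (H' 0 0).re ∨
        (H 0 0 = H' 0 0 ∧
          ((H 0 1).re < (H' 0 1).re ∨
            ((H 0 1).re = (H' 0 1).re ∧ (H 0 1).im < (H' 0 1).im)))))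

/-- The Siegel upper half-space of degree `n`: symmetric complex matrices with
positive definite imaginary part. -/
def SiegelUpperHalfSpace (n : ℕ) : Set (Matrix (Fin n) (Fin n) ℂ) :=
  {Z | Z.IsSymm ∧ ((Z - Zᴴ).map (fun w => w / (2 * Complex.I))).PosDef}

/-- The symplectic-form matrix over `ℤ` in degree `n`. -/
def Jn (n : ℕ) : Matrix (Fin n ⊕ Fin n) (Fin n ⊕ Fin n) ℤ :=
  Matrix.fromBlocks 0 (-1) 1 0

/-- The Siegel modular group `Γ_n = Sp_n(ℤ)` (as a set of `2n × 2n` integer matrices). -/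
def SiegelModularGroup (n : ℕ) : Set (Matrix (Fin n ⊕ Fin n) (Fin n ⊕ Fin n) ℤ) :=
  {M | Mᵀ * Jn n * M = Jn n}

/-- The fractional-linear action of an integral symplectic matrix on the Siegel
upper half-space. -/
def matActS {n : ℕ} (M : Matrix (Fin n ⊕ Fin n) (Fin n ⊕ Fin n) ℤ)
    (Z : Matrix (Fin n) (Fin n) ℂ) : Matrix (Fin n) (Fin n) ℂ :=
  ((M.map (fun a => (a : ℂ))).toBlocks₁₁ * Z + (M.map (fun a => (a : ℂ))).toBlocks₁₂) *
    ((M.map (fun a => (a : ℂ))).toBlocks₂₁ * Z + (M.map (fun a => (a : ℂ))).toBlocks₂₂)⁻¹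

/-- The index lattice of Fourier expansions of Siegel modular forms of level `N`:
semi-positive symmetric rational matrices `T` with `N·T` half-integral,
i.e. `T ∈ (1/N)Λ_n`. -/
def SiegelLattice (n : ℕ) (N : ℕ) : Set (Matrix (Fin n) (Fin n) ℚ) :=
  {T | T.IsSymm ∧ (∀ i, ∃ a : ℤ, (N : ℚ) * T i i = (a : ℚ)) ∧
    (∀ i j, ∃ a : ℤ, 2 * (N : ℚ) * T i j = (a : ℚ)) ∧
    (T.map (fun q => (q : ℝ))).PosSemidef}

/-- A Siegel modular form of degree `n` and weight `k` for a subgroup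
`Γ ⊆ Γ_n = Sp_n(ℤ)` of level `N`, bundled with its Fourier expansion. For the
full modular group take `Γ = SiegelModularGroup n` and `N = 1`. -/
structure SiegelModularForm (n : ℕ) (k : ℤ)
    (Γ : Set (Matrix (Fin n ⊕ Fin n) (Fin n ⊕ Fin n) ℤ)) (N : ℕ) where
  toFun : Matrix (Fin n) (Fin n) ℂ → ℂ
  coeff : Matrix (Fin n) (Fin n) ℚ → ℂ
  holo : DifferentiableOn ℂ (fun Z : Fin n → Fin n → ℂ => toFun (Matrix.of Z))
    {Z | Matrix.of Z ∈ SiegelUpperHalfSpace n}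
  transform : ∀ M ∈ Γ, ∀ Z ∈ SiegelUpperHalfSpace n,
    toFun (matActS M Z) =
      ((M.map (fun a => (a : ℂ))).toBlocks₂₁ * Z +
        (M.map (fun a => (a : ℂ))).toBlocks₂₂).det ^ k * toFun Z
  coeff_supported : ∀ T, coeff T ≠ 0 → T ∈ SiegelLattice n N
  expansion : ∀ Z ∈ SiegelUpperHalfSpace n,
    HasSum (fun T : SiegelLattice n N =>
      coeff T * Complex.exp (2 * Real.pi * Complex.I *
        (((T : Matrix (Fin n) (Fin n) ℚ).map (fun q => (q : ℂ))) * Z).trace))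
      (toFun Z)


/-- A Hermitian cusp form (degree 2, class number one field): the Fourier
coefficients vanish off the positive definite part of the lattice. -/
def IsCuspHMF {d k : ℤ} (f : HermitianModularForm d k) : Prop :=
  ∀ H, ¬ H.PosDef → f.coeff H = 0

/-- `H0 = ord_p f`: `H0` is the minimal element of `Λ₂(K)`, in the lexicographic
order `lexLt`, whose Fourier coefficient is not divisible by `p`. -/
def IsOrdP (p : ℕ) {d k : ℤ} (f : HermitianModularForm d k)
    (H0 : Matrix (Fin 2) (Fin 2) ℂ) : Prop :=
  H0 ∈ HermLattice d ∧ ¬ ModCongr p 1 (f.coeff H0) 0 ∧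
    ∀ H ∈ HermLattice d, lexLt H H0 → ModCongr p 1 (f.coeff H) 0

open Filter Topology UpperHalfPlane in
/-- A holomorphic function on the upper half-plane whose absolute value is invariant under the
modular group and which tends to zero at the cusp vanishes identically. -/
theorem eq_zero_of_norm_invariant_of_decay {P : ℂ → ℂ}
    (hd : DifferentiableOn ℂ P {z | 0 < z.im})
    (hT : ∀ z : ℂ, 0 < z.im → ‖P (z + 1)‖ = ‖P z‖)
    (hS : ∀ z : ℂ, 0 < z.im → ‖P (-1 / z)‖ = ‖P z‖)
    (h0 : ∀ ε > 0, ∃ Y : ℝ, ∀ z : ℂ, Y ≤ z.im → ‖P z‖ < ε) :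
    ∀ z : ℂ, 0 < z.im → P z = 0 := by
  have hinv : ∀ γ : Matrix.SpecialLinearGroup (Fin 2) ℤ, ∀ τ : ℍ, ‖P (γ • τ : ℍ)‖ = ‖P τ‖ := by
    intro γ
    have hγ : γ ∈ Subgroup.closure {ModularGroup.S, ModularGroup.T} := by
      simp [SpecialLinearGroup.SL2Z_generators]
    induction hγ using Subgroup.closure_induction with
    | mem x hx =>
      intro τ
      rcases hx with rfl | hx
      · rw [UpperHalfPlane.modular_S_smul]
        have := hS τ τ.2
        rw [← this]
        congr 2
        simp [neg_div]
      · rw [Set.mem_singleton_iff] at hx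
        subst hx
        rw [UpperHalfPlane.modular_T_smul]
        rw [← hT τ τ.2]
        congr 2
        simp [add_comm]
    | one => simp
    | mul x y _ _ hx hy => intro τ; rw [mul_smul, hx, hy]
    | inv x _ hx => intro τ; rw [← hx, smul_inv_smul]
  by_contra! hne
  obtain ⟨p, hp, hPp⟩ := hne
  obtain ⟨Y, hY⟩ := h0 ‖P p‖ (norm_pos_iff.mpr hPp)
  let K : Set ℂ := Set.Icc (-(1 / 2) : ℝ) (1 / 2) ×ℂ Set.Icc (1 / 2 : ℝ) Y
  have hKc : IsCompact K := isCompact_Icc.reProdIm isCompact_Icc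
  have hK : ∀ z : ℂ, 0 < z.im → ‖P p‖ ≤ ‖P z‖ → ∃ w ∈ K, ‖P w‖ = ‖P z‖ := by
    intro z hz hpz
    obtain ⟨γ, hγ⟩ := ModularGroup.exists_smul_mem_fd ⟨z, hz⟩
    refine ⟨(γ • (⟨z, hz⟩ : ℍ) : ℍ), ?_, hinv γ ⟨z, hz⟩⟩
    have h3 := ModularGroup.three_le_four_mul_im_sq_of_mem_fd hγ
    have hpos := (γ • (⟨z, hz⟩ : ℍ)).im_pos
    rw [mem_reProdIm]
    refine ⟨abs_le.mp hγ.2, ?_, ?_⟩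
    · change 1 / 2 ≤ (γ • (⟨z, hz⟩ : ℍ)).im
      nlinarith
    · by_contra! hlt
      have := hY _ hlt.le
      rw [hinv γ ⟨z, hz⟩] at this
      exact absurd this (not_lt.mpr hpz)
  have hKne : K.Nonempty := let ⟨w, hw, _⟩ := hK p hp le_rfl; ⟨w, hw⟩
  have hKpos : ∀ w ∈ K, 0 < w.im := fun w hw => by
    rw [mem_reProdIm] at hw
    linarith [hw.2.1]
  obtain ⟨c, hcK, hc⟩ := hKc.exists_isMaxOn hKne
    ((hd.continuousOn.mono hKpos).norm)
  have hpc : ‖P p‖ ≤ ‖P c‖ := by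
    obtain ⟨w, hw, hw'⟩ := hK p hp le_rfl
    rw [← hw']
    exact hc hw
  have hmax : IsMaxOn (norm ∘ P) {z : ℂ | 0 < z.im} c := by
    intro z hz
    simp only [Set.mem_ofPred_eq, Function.comp_apply]
    rcases le_total ‖P p‖ ‖P z‖ with h | h
    · obtain ⟨w, hw, hw'⟩ := hK z hz h
      rw [← hw']
      exact hc hw
    · exact h.trans hpc
  have hconst := Complex.eqOn_of_isPreconnected_of_isMaxOn_norm
    (convex_halfSpace_im_gt 0).isPreconnected (isOpen_lt continuous_const continuous_im)
    hd (hKpos c hcK) hmax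
  have hw : (0 : ℝ) < ((max Y 1 : ℝ) * Complex.I : ℂ).im := by simp
  have h1 := hconst hw
  have h2 := hY ((max Y 1 : ℝ) * Complex.I : ℂ) (by simp)
  rw [h1] at h2
  exact absurd hpc (not_le.mpr h2)

open Filter Topology UpperHalfPlane ModularForm in
theorem eta_pow_zpow_bound (j : ℤ) : ∃ C Y : ℝ, 0 < C ∧ ∀ z : ℂ, 0 < z.im → Y ≤ z.im →
    ‖(ModularForm.eta z ^ 24) ^ j‖ ≤ C * Real.exp (-2 * Real.pi * j * z.im) := by
  have h := tendsto_atImInfty_tprod_one_sub_eta_q_pow.norm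
  rw [norm_one] at h
  have h' := (h.zpow₀ j (Or.inl one_ne_zero)).eventually_le_const
    (show (1 : ℝ) ^ j < 2 by simp)
  rw [atImInfty, Filter.eventually_comap, Filter.eventually_atTop] at h'
  obtain ⟨Y, hY⟩ := h'
  refine ⟨2, Y, two_pos, fun z hz hYz => ?_⟩
  have key := hY z.im hYz ⟨z, hz⟩ rfl
  have hq := discriminant_eq_q_prod ⟨z, hz⟩
  rw [show ModularForm.eta z ^ 24 = _ from hq, norm_zpow, norm_mul, mul_zpow, mul_comm]
  have hn : ‖Function.Periodic.qParam 1 z‖ ^ j = Real.exp (-2 * Real.pi * j * z.im) := by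
    rw [Function.Periodic.norm_qParam, ← Real.rpow_intCast, ← Real.exp_mul]
    congr 1
    ring
  gcongr
  exact hn.le

theorem eta_add_one_pow (z : ℂ) (hz : 0 < z.im) :
    ModularForm.eta (z + 1) ^ 24 = ModularForm.eta z ^ 24 := by
  have h1 := ModularForm.discriminant_eq_q_prod ⟨z, hz⟩
  have h2 := ModularForm.discriminant_eq_q_prod ⟨z + 1, by simpa using hz⟩
  have hq : Function.Periodic.qParam 1 (z + 1) = Function.Periodic.qParam 1 z := by
    simp [Function.Periodic.qParam, mul_add, Complex.exp_add]
  rw [show ModularForm.eta z ^ 24 = _ from h1, show ModularForm.eta (z + 1) ^ 24 = _ from h2]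
  simp only [ModularForm.eta_q, hq]

theorem norm_eta_neg_one_div_pow (z : ℂ) (hz : 0 < z.im) :
    ‖ModularForm.eta (-1 / z)‖ ^ 24 = ‖z‖ ^ 12 * ‖ModularForm.eta z‖ ^ 24 := by
  have h := ModularForm.eta_comp_eq_csqrt_I_inv hz
  simp only [Function.comp_apply, Pi.smul_apply, Pi.mul_apply, smul_eq_mul] at h
  have hsq : ∀ w : ℂ, ‖Complex.sqrt w‖ ^ 24 = ‖w‖ ^ 12 := fun w => by
    rw [show 24 = 2 * 12 from rfl, pow_mul, ← norm_pow, Complex.sqrt, cpow_ofNat_inv_pow]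
  rw [h, norm_mul, norm_mul, norm_inv, mul_pow, mul_pow, inv_pow, hsq, hsq]
  simp

/-- The valence inequality for a finite family of holomorphic functions on the upper half-plane
which is permuted, up to factors of absolute value one, by the modular group in weight `k`. -/
theorem valence_inequality {ι : Type*} (O : Finset ι) (G : ι → ℂ → ℂ) (s t : Equiv.Perm ι)
    (hs : ∀ x, s x ∈ O ↔ x ∈ O) (ht : ∀ x, t x ∈ O ↔ x ∈ O) (k : ℤ) (e : ι → ℝ)
    (hd : ∀ x ∈ O, DifferentiableOn ℂ (G x) {z | 0 < z.im})
    (hT : ∀ x ∈ O, ∀ z : ℂ, 0 < z.im → ‖G x (z + 1)‖ = ‖G (t x) z‖)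
    (hS : ∀ x ∈ O, ∀ z : ℂ, 0 < z.im → ‖G x (-1 / z)‖ = ‖z‖ ^ k * ‖G (s x) z‖)
    (hb : ∀ x ∈ O, ∃ C : ℝ, 0 ≤ C ∧
      ∀ z : ℂ, 1 ≤ z.im → ‖G x z‖ ≤ C * Real.exp (-2 * Real.pi * e x * z.im))
    (hne : ∀ x ∈ O, ∃ z : ℂ, 0 < z.im ∧ G x z ≠ 0) :
    12 * ∑ x ∈ O, e x ≤ k * O.card := by
  by_contra! hlt
  let j : ℤ := -(k * O.card)
  let P : ℂ → ℂ := fun z => (∏ x ∈ O, G x z ^ 12) * (ModularForm.eta z ^ 24) ^ j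
  have heta : ∀ z : ℂ, 0 < z.im → ModularForm.eta z ≠ 0 := fun z hz => ModularForm.eta_ne_zero hz
  have hPd : DifferentiableOn ℂ P {z | 0 < z.im} := by
    refine DifferentiableOn.mul (DifferentiableOn.fun_finsetProd fun x hx => (hd x hx).pow 12) ?_
    intro z hz
    refine DifferentiableAt.differentiableWithinAt (DifferentiableAt.zpow ?_ (Or.inl ?_))
    · exact (ModularForm.differentiableAt_eta_of_mem_upperHalfPlaneSet hz).pow 24
    · exact pow_ne_zero _ (heta z hz)
  have hPT : ∀ z : ℂ, 0 < z.im → ‖P (z + 1)‖ = ‖P z‖ := by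
    intro z hz
    have h1 : ∏ x ∈ O, ‖G x (z + 1)‖ ^ 12 = ∏ x ∈ O, ‖G x z‖ ^ 12 := by
      rw [Finset.prod_congr rfl fun x hx => by rw [hT x hx z hz]]
      exact Finset.prod_equiv t (fun x => (ht x).symm) fun x _ => rfl
    have h2 := eta_add_one_pow z hz
    simp only [P, norm_mul, norm_prod, norm_pow, h1, h2]
  have hPS : ∀ z : ℂ, 0 < z.im → ‖P (-1 / z)‖ = ‖P z‖ := by
    intro z hz
    have hz0 : z ≠ 0 := by rintro rfl; simp at hz
    have hnz : ‖z‖ ≠ 0 := norm_ne_zero_iff.mpr hz0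
    have h1 : ∏ x ∈ O, ‖G x (-1 / z)‖ ^ 12
        = (‖z‖ ^ 12) ^ (k * O.card) * ∏ x ∈ O, ‖G x z‖ ^ 12 := by
      rw [Finset.prod_congr rfl fun x hx => by rw [hS x hx z hz, mul_pow],
        Finset.prod_mul_distrib, Finset.prod_const]
      congr 1
      · rw [← zpow_natCast, ← zpow_natCast, ← zpow_natCast, ← _root_.zpow_mul,
          ← _root_.zpow_mul, ← _root_.zpow_mul]
        congr 1
        ring
      · exact Finset.prod_equiv s (fun x => (hs x).symm) fun x _ => rfl
    have h2 := norm_eta_neg_one_div_pow z hz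
    simp only [P, norm_mul, norm_prod, norm_pow, norm_zpow, h1, h2, j]
    rw [mul_zpow, zpow_neg (‖z‖ ^ 12)]
    field_simp
  have hP0 : ∀ ε > 0, ∃ Y : ℝ, ∀ z : ℂ, Y ≤ z.im → ‖P z‖ < ε := by
    intro ε hε
    choose! C hC0 hC using hb
    obtain ⟨C', Y', hC', hY'⟩ := eta_pow_zpow_bound j
    let A : ℝ := (∏ x ∈ O, C x ^ 12) * C'
    let B : ℝ := 2 * Real.pi * (12 * ∑ x ∈ O, e x - k * O.card)
    have hB : 0 < B := by
      have := Real.pi_pos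
      have : 0 < 12 * ∑ x ∈ O, e x - k * O.card := by linarith
      positivity
    have hbound : ∀ z : ℂ, max 1 Y' ≤ z.im → ‖P z‖ ≤ A * Real.exp (-B * z.im) := by
      intro z hz
      have hz1 : 1 ≤ z.im := (le_max_left _ _).trans hz
      simp only [P, norm_mul, norm_prod, norm_pow]
      calc _ ≤ (∏ x ∈ O, (C x * Real.exp (-2 * Real.pi * e x * z.im)) ^ 12) *
            (C' * Real.exp (-2 * Real.pi * j * z.im)) := by
            have hp : ∏ x ∈ O, ‖G x z‖ ^ 12 ≤
                ∏ x ∈ O, (C x * Real.exp (-2 * Real.pi * e x * z.im)) ^ 12 := by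
              refine Finset.prod_le_prod (fun _ _ => by positivity) fun x hx => ?_
              exact pow_le_pow_left₀ (norm_nonneg _) (hC x hx z hz1) 12
            refine mul_le_mul hp (hY' z (by linarith) ((le_max_right _ _).trans hz))
              (norm_nonneg _) ?_
            exact Finset.prod_nonneg fun x hx => by have := hC0 x hx; positivity
        _ = A * Real.exp (-B * z.im) := by
            simp only [mul_pow, Finset.prod_mul_distrib, ← Real.exp_nat_mul, ← Real.exp_sum, A]
            rw [mul_mul_mul_comm, ← Real.exp_add]
            congr 2
            simp only [B, j, ← Finset.mul_sum, ← Finset.sum_mul]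
            push_cast
            ring
    have hlim : Filter.Tendsto (fun y : ℝ => A * Real.exp (-B * y)) Filter.atTop (nhds 0) := by
      have : Filter.Tendsto (fun y : ℝ => -B * y) Filter.atTop Filter.atBot :=
        Filter.tendsto_id.const_mul_atTop_of_neg (by linarith)
      simpa using (Real.tendsto_exp_atBot.comp this).const_mul A
    obtain ⟨Y, hY⟩ := Filter.eventually_atTop.mp (hlim.eventually_lt_const hε)
    exact ⟨max Y (max 1 Y'), fun z hz =>
      (hbound z ((le_max_right _ _).trans hz)).trans_lt (hY _ ((le_max_left _ _).trans hz))⟩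
  have hPz := eq_zero_of_norm_invariant_of_decay hPd hPT hPS hP0
  have hopen : IsOpen {z : ℂ | 0 < z.im} := isOpen_lt continuous_const continuous_im
  have hconn : IsPreconnected {z : ℂ | 0 < z.im} := (convex_halfSpace_im_gt 0).isPreconnected
  have hprod : ∀ z : ℂ, 0 < z.im → ∏ x ∈ O, G x z = 0 := by
    intro z hz
    have h := hPz z hz
    simp only [P, mul_eq_zero, Finset.prod_pow] at h
    rcases h with h | h
    · simpa using h
    · exact absurd h (zpow_ne_zero _ (pow_ne_zero _ (heta z hz)))
  have hall : ∀ O' ⊆ O, ∃ z : ℂ, 0 < z.im ∧ ∏ x ∈ O', G x z ≠ 0 := by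
    classical
    intro O'
    induction O' using Finset.induction_on with
    | empty => exact fun _ => ⟨I, by simp, by simp⟩
    | insert a O' ha ih =>
      intro hsub
      by_contra! hcon
      have hOs : O' ⊆ O := (Finset.subset_insert _ _).trans hsub
      have haO : a ∈ O := hsub (Finset.mem_insert_self _ _)
      obtain ⟨z₁, hz₁, h₁⟩ := ih hOs
      obtain ⟨z₂, hz₂, h₂⟩ := hne a haO
      have hA1 : AnalyticOnNhd ℂ (G a) {z | 0 < z.im} := (hd a haO).analyticOnNhd hopen
      have hA2 : AnalyticOnNhd ℂ (fun z => ∏ x ∈ O', G x z) {z | 0 < z.im} :=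
        (DifferentiableOn.fun_finsetProd fun x hx => hd x (hOs hx)).analyticOnNhd hopen
      have hz : ∀ᶠ z in nhdsWithin z₁ {z₁}ᶜ, G a z = 0 := by
        have hc : ∀ᶠ z in nhds z₁, ∏ x ∈ O', G x z ≠ 0 :=
          (hA2 z₁ hz₁).continuousAt.eventually_ne h₁
        filter_upwards [nhdsWithin_le_nhds hc, nhdsWithin_le_nhds (hopen.mem_nhds hz₁)]
          with z hz hzim
        have := hcon z hzim
        rw [Finset.prod_insert ha, mul_eq_zero] at this
        exact this.resolve_right hz
      exact h₂ (hA1.eqOn_zero_of_preconnected_of_frequently_eq_zero hconn hz₁ hz.frequently hz₂)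
  obtain ⟨z, hz, h⟩ := hall O subset_rfl
  exact h (hprod z hz)

theorem sum_bernoulli_two (N : ℕ) (hN : N ≠ 0) :
    ∑ j ∈ Finset.range N, (((j : ℝ) / N) ^ 2 - (j : ℝ) / N + 1 / 6) = 1 / (6 * (N : ℝ)) := by
  have h1 : ∀ n : ℕ, ∑ j ∈ Finset.range n, (j : ℝ) = n * (n - 1) / 2 := by
    intro n
    induction n with
    | zero => simp
    | succ n ih => rw [Finset.sum_range_succ, ih]; push_cast; ring
  have h2 : ∀ n : ℕ, ∑ j ∈ Finset.range n, (j : ℝ) ^ 2 = n * (n - 1) * (2 * n - 1) / 6 := by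
    intro n
    induction n with
    | zero => simp
    | succ n ih => rw [Finset.sum_range_succ, ih]; push_cast; ring
  have hN' : (N : ℝ) ≠ 0 := by exact_mod_cast hN
  simp only [div_pow, Finset.sum_add_distrib, Finset.sum_sub_distrib, ← Finset.sum_div, h1, h2]
  simp
  field_simp
  ring

/-- A function on `(ℤ/N)²` with `N` prime that is nondecreasing along the two standard
generators of the modular group is constant away from the origin. -/
theorem constant_of_le_generators {N : ℕ} [Fact N.Prime] (c : ZMod N × ZMod N → ℕ)
    (hS : ∀ x y, c (x, y) ≤ c (y, -x)) (hT : ∀ x y, c (x, y) ≤ c (x, y + x))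
    {w w' : ZMod N × ZMod N} (hw : w ≠ 0) (hw' : w' ≠ 0) : c w = c w' := by
  have hTn : ∀ (n : ℕ) x y, c (x, y) ≤ c (x, y + n * x) := by
    intro n x y
    induction n with
    | zero => simp
    | succ n ih =>
      refine ih.trans ((hT _ _).trans (le_of_eq ?_))
      congr 2
      push_cast
      ring
  have hany : ∀ x y y', x ≠ 0 → c (x, y) ≤ c (x, y') := by
    intro x y y' hx
    have := hTn ((y' - y) / x).val x y
    rwa [ZMod.natCast_zmod_val, div_mul_cancel₀ _ hx, add_sub_cancel] at this
  have hfst : ∀ x y x' y', x ≠ 0 → x' ≠ 0 → c (x, y) ≤ c (x', y') := by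
    intro x y x' y' hx hx'
    calc c (x, y) ≤ c (x, 1) := hany _ _ _ hx
      _ ≤ c (1, -x) := hS _ _
      _ ≤ c (1, x') := hany _ _ _ one_ne_zero
      _ ≤ c (x', -1) := hS _ _
      _ ≤ c (x', y') := hany _ _ _ hx'
  have hle : ∀ w w' : ZMod N × ZMod N, w ≠ 0 → w' ≠ 0 → c w ≤ c w' := by
    rintro ⟨x, y⟩ ⟨x', y'⟩ h h'
    have hto : ∃ a b, a ≠ 0 ∧ c (x, y) ≤ c (a, b) := by
      by_cases hx : x = 0
      · exact ⟨y, -x, fun hy => h (by simp [hx, hy]), hS _ _⟩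
      · exact ⟨x, y, hx, le_rfl⟩
    have hfrom : ∃ a b, a ≠ 0 ∧ c (a, b) ≤ c (x', y') := by
      by_cases hx : x' = 0
      · refine ⟨-y', x', fun hy => h' (by simpa [hx] using hy), ?_⟩
        simpa using hS (-y') x'
      · exact ⟨x', y', hx, le_rfl⟩
    obtain ⟨a, b, ha, hab⟩ := hto
    obtain ⟨a', b', ha', hab'⟩ := hfrom
    exact hab.trans ((hfst _ _ _ _ ha ha').trans hab')
  exact le_antisymm (hle _ _ hw hw') (hle _ _ hw' hw)

/-- The second Bernoulli polynomial has nonnegative sum over any finite set fibred equivariantly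
over `(ℤ/N)²`, `N` prime. -/
theorem sum_bernoulli_two_nonneg {N : ℕ} [Fact N.Prime] {ι : Type*} (O : Finset ι)
    (s t : Equiv.Perm ι) (hs : ∀ x, s x ∈ O ↔ x ∈ O) (ht : ∀ x, t x ∈ O ↔ x ∈ O)
    (π : ι → ZMod N × ZMod N) (hπs : ∀ x, π (s x) = ((π x).2, -(π x).1))
    (hπt : ∀ x, π (t x) = ((π x).1, (π x).2 + (π x).1)) :
    0 ≤ ∑ x ∈ O, ((((π x).1.val : ℝ) / N) ^ 2 - ((π x).1.val : ℝ) / N + 1 / 6) := by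
  classical
  let B : ZMod N → ℝ := fun a => ((a.val : ℝ) / N) ^ 2 - (a.val : ℝ) / N + 1 / 6
  let c : ZMod N × ZMod N → ℕ := fun w => (O.filter (fun x => π x = w)).card
  have hcS : ∀ x y, c (x, y) ≤ c (y, -x) := by
    intro x y
    refine Finset.card_le_card_of_injOn s (fun i hi => ?_) s.injective.injOn
    simp only [Finset.coe_filter, Set.mem_ofPred_eq] at hi ⊢
    exact ⟨(hs i).mpr hi.1, by rw [hπs, hi.2]⟩
  have hcT : ∀ x y, c (x, y) ≤ c (x, y + x) := by
    intro x y
    refine Finset.card_le_card_of_injOn t (fun i hi => ?_) t.injective.injOn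
    simp only [Finset.coe_filter, Set.mem_ofPred_eq] at hi ⊢
    exact ⟨(ht i).mpr hi.1, by rw [hπt, hi.2]⟩
  have hN : N ≠ 0 := (Fact.out : N.Prime).ne_zero
  have hsumB : ∑ a : ZMod N, B a = 1 / (6 * N) := by
    rw [← sum_bernoulli_two N hN]
    refine Finset.sum_bij (fun a _ => a.val) (fun a _ => Finset.mem_range.mpr a.val_lt)
      (fun a _ b _ h => ZMod.val_injective N h)
      (fun j hj => ⟨(j : ZMod N), Finset.mem_univ _, ?_⟩) (fun a _ => rfl)
    exact ZMod.val_cast_of_lt (Finset.mem_range.mp hj)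
  have hsum2 : ∑ w : ZMod N × ZMod N, B w.1 = 1 / 6 := by
    rw [Fintype.sum_prod_type]
    simp only [Finset.sum_const, Finset.card_univ, ZMod.card, nsmul_eq_mul, ← Finset.mul_sum,
      hsumB]
    have : (N : ℝ) ≠ 0 := by exact_mod_cast hN
    field_simp
  have hB0 : B 0 = 1 / 6 := by simp [B]
  have hfib : ∑ x ∈ O, B (π x).1 = ∑ w : ZMod N × ZMod N, (c w : ℝ) * B w.1 := by
    rw [← Finset.sum_fiberwise O π]
    refine Finset.sum_congr rfl fun w _ => ?_
    rw [Finset.sum_congr rfl (g := fun _ => B w.1), Finset.sum_const, nsmul_eq_mul]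
    intro x hx
    rw [(Finset.mem_filter.mp hx).2]
  have hdiff : ∑ w : ZMod N × ZMod N, ((c w : ℝ) - c (1, 0)) * B w.1
      = ((c 0 : ℝ) - c (1, 0)) * (1 / 6) := by
    rw [Finset.sum_eq_single 0]
    · rw [Prod.fst_zero, hB0]
    · intro w _ hw
      rw [constant_of_le_generators c hcS hcT hw (w' := (1, 0)) (by simp)]
      simp
    · simp
  have htot : ∑ x ∈ O, B (π x).1 = c 0 * (1 / 6) := by
    rw [hfib]
    simp only [sub_mul, Finset.sum_sub_distrib, ← Finset.mul_sum, hsum2] at hdiff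
    linarith
  change 0 ≤ ∑ x ∈ O, B (π x).1
  rw [htot]
  positivity

open UnitAddTorus in
/-- An absolutely convergent multiple Fourier series with sum zero has vanishing coefficients. -/
theorem eq_zero_of_fourier_series_eq_zero {ι : Type*} [Fintype ι] (c : (ι → ℤ) → ℂ)
    (hc : Summable c)
    (h : ∀ x : ι → ℝ, HasSum (fun n => c n * cexp (2 * Real.pi * I * ∑ i, n i * x i)) 0) :
    c = 0 := by
  have hsum : Summable fun n => c n • mFourier n := by
    refine Summable.of_norm ?_
    simpa [norm_smul, mFourier_norm] using hc.norm
  have hzero : HasSum (fun n => c n • mFourier n) 0 := by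
    convert hsum.hasSum
    symm
    ext y
    obtain ⟨x, rfl⟩ : ∃ x : ι → ℝ, (fun i => (x i : UnitAddCircle)) = y :=
      ⟨fun i => (QuotientAddGroup.mk_surjective (y i)).choose,
        funext fun i => (QuotientAddGroup.mk_surjective (y i)).choose_spec⟩
    have h1 := ContinuousMap.hasSum_apply hsum.hasSum (fun i => (x i : UnitAddCircle))
    refine (h1.unique (a₂ := 0) ?_).trans (by simp)
    convert h x using 2 with n
    simp only [ContinuousMap.coe_smul, Pi.smul_apply, smul_eq_mul, mFourier,
      ContinuousMap.coe_mk, fourier_coe_apply, ← Complex.exp_sum]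
    simp
    left
    rw [Finset.mul_sum]
    refine congrArg cexp (Finset.sum_congr rfl fun i _ => ?_)
    ring
  funext n
  have h2 : HasSum (fun m => c m • mFourierLp (d := ι) 2 m) 0 := by
    have := (ContinuousMap.toLp (E := ℂ) (α := UnitAddTorus ι) 2
      (MeasureTheory.Measure.pi fun _ => AddCircle.haarAddCircle) ℂ).hasSum hzero
    simp only [map_smul, map_zero] at this
    exact this
  have h3 := (innerSL ℂ (mFourierLp (d := ι) 2 n)).hasSum h2
  have h4 := orthonormal_iff_ite.mp (orthonormal_mFourier (d := ι))
  have h5 : HasSum (fun m => if m = n then c n else 0) (0 : ℂ) := by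
    rw [map_zero] at h3
    refine h3.congr_fun fun m => ?_
    rw [map_smul, innerSL_apply_apply, h4 n m, smul_eq_mul]
    by_cases hmn : m = n
    · simp [hmn]
    · simp [hmn, Ne.symm hmn]
  exact (hasSum_ite_eq n (c n)).unique h5

/-- The term of index `h` of a Fourier series in four variables. -/
def fourierTerm (c : (Fin 4 → ℤ) → ℂ) (W : Fin 4 → ℂ) (h : Fin 4 → ℤ) : ℂ :=
  c h * cexp (2 * Real.pi * I * ∑ i, h i * W i)

/-- The Hermitian half-space of degree two, in coordinates of the tube over the light cone. -/
def lightTube : Set (Fin 4 → ℂ) :=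
  {W | 0 < (W 3).im ∧ (W 1).im ^ 2 + (W 2).im ^ 2 < (W 0).im * (W 3).im}

theorem fourierTerm_add (c : (Fin 4 → ℤ) → ℂ) (W V : Fin 4 → ℂ) (h : Fin 4 → ℤ) :
    fourierTerm c (W + V) h =
      fourierTerm c W h * cexp (2 * Real.pi * I * ∑ i, h i * V i) := by
  simp only [fourierTerm, Pi.add_apply, mul_add, Finset.sum_add_distrib, Complex.exp_add]
  ring

theorem fourierTerm_eq_zero {c : (Fin 4 → ℤ) → ℂ} {h : Fin 4 → ℤ} (hc : c h = 0)
    (W : Fin 4 → ℂ) : fourierTerm c W h = 0 := by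
  simp [fourierTerm, hc]

/-- If a Fourier series vanishes on all real translates of a point where it converges absolutely,
then its coefficients vanish. -/
theorem eq_zero_of_fourierTerm_hasSum_zero {c : (Fin 4 → ℤ) → ℂ} (W : Fin 4 → ℂ)
    (h : ∀ x : Fin 4 → ℝ, HasSum (fourierTerm c (W + fun i => (x i : ℂ))) 0) : c = 0 := by
  have h0 : fourierTerm c W = 0 := by
    refine eq_zero_of_fourier_series_eq_zero _ ?_ fun x => ?_
    · have := (h 0).summable
      have h' : (W + fun i => (((0 : Fin 4 → ℝ) i : ℝ) : ℂ)) = W := by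
        funext i
        simp
      rwa [h'] at this
    · convert h x using 2 with n
      rw [fourierTerm_add]
      push_cast
      rfl
  funext n
  have := congrFun h0 n
  simpa [fourierTerm] using this

theorem add_real_mem_lightTube {W : Fin 4 → ℂ} (hW : W ∈ lightTube) (x : Fin 4 → ℝ) :
    (W + fun i => (x i : ℂ)) ∈ lightTube := by
  simpa [lightTube] using hW

theorem fourierTerm_comp_perm (c : (Fin 4 → ℤ) → ℂ) (σ : Equiv.Perm (Fin 4 → ℤ))
    {W W' : Fin 4 → ℂ} (hσ : ∀ h : Fin 4 → ℤ, ∑ i, (h i : ℂ) * W' i = ∑ i, (σ h i : ℂ) * W i)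
    {a : ℂ} (ha : HasSum (fourierTerm c W') a) : HasSum (fourierTerm (c ∘ σ.symm) W) a := by
  rw [← σ.hasSum_iff]
  refine ha.congr_fun fun h => ?_
  simp [fourierTerm, hσ]

/-- A linear substitution that preserves the sum of a Fourier series preserves its coefficients. -/
theorem coeff_comp_eq {A : (Fin 4 → ℤ) → ℂ} {F : (Fin 4 → ℂ) → ℂ}
    (hF : ∀ W ∈ lightTube, HasSum (fourierTerm A W) (F W)) (σ : Equiv.Perm (Fin 4 → ℤ))
    (T : (Fin 4 → ℂ) → Fin 4 → ℂ) (hT : ∀ W ∈ lightTube, T W ∈ lightTube)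
    (hσ : ∀ (h : Fin 4 → ℤ) W, ∑ i, (h i : ℂ) * T W i = ∑ i, (σ h i : ℂ) * W i)
    (hFT : ∀ W ∈ lightTube, F (T W) = F W) (h : Fin 4 → ℤ) : A (σ h) = A h := by
  have hW : ![I, 0, 0, I] ∈ lightTube := by simp [lightTube]
  have key : (fun n => A n - (A ∘ σ.symm) n) = 0 := by
    refine eq_zero_of_fourierTerm_hasSum_zero ![I, 0, 0, I] fun x => ?_
    have hx := add_real_mem_lightTube hW x
    have h2 := fourierTerm_comp_perm A σ (fun h => hσ h _) (hF _ (hT _ hx))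
    rw [hFT _ hx] at h2
    have h3 := (hF _ hx).sub h2
    rw [sub_self] at h3
    refine h3.congr_fun fun n => ?_
    simp [fourierTerm, sub_mul]
  have := congrFun key (σ h)
  simpa [sub_eq_zero] using this

/-- The substitution `Z ↦ U Z ᵗŪ` for the transposition `U`, on Fourier indices. -/
def swapIndex : Equiv.Perm (Fin 4 → ℤ) where
  toFun h := ![h 3, h 1, -h 2, h 0]
  invFun h := ![h 3, h 1, -h 2, h 0]
  left_inv h := by ext i; fin_cases i <;> simp
  right_inv h := by ext i; fin_cases i <;> simp

/-- The substitution `Z ↦ U Z ᵗŪ` for a unipotent `U`, on Fourier indices. -/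
def shearIndex (x y : ℤ) : Equiv.Perm (Fin 4 → ℤ) where
  toFun h := ![h 0, h 1 + 2 * h 0 * x, h 2 + 2 * h 0 * y,
    h 3 + h 1 * x + h 2 * y + h 0 * (x ^ 2 + y ^ 2)]
  invFun h := ![h 0, h 1 - 2 * h 0 * x, h 2 - 2 * h 0 * y,
    h 3 - h 1 * x - h 2 * y + h 0 * (x ^ 2 + y ^ 2)]
  left_inv h := by ext i; fin_cases i <;> simp; ring
  right_inv h := by ext i; fin_cases i <;> simp; ring

/-- The substitution `Z ↦ U Z ᵗŪ` for a unipotent `U`. -/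
def shear (x y : ℤ) (W : Fin 4 → ℂ) : Fin 4 → ℂ :=
  ![W 0 + 2 * x * W 1 + 2 * y * W 2 + (x ^ 2 + y ^ 2) * W 3, W 1 + x * W 3, W 2 + y * W 3, W 3]

/-- The inversion in the last variable. -/
def inversion (W : Fin 4 → ℂ) : Fin 4 → ℂ :=
  ![W 0 - (W 1 ^ 2 + W 2 ^ 2) / W 3, W 1 / W 3, W 2 / W 3, -1 / W 3]

theorem swap_mem_lightTube {W : Fin 4 → ℂ} (hW : W ∈ lightTube) :
    ![W 3, W 1, -W 2, W 0] ∈ lightTube := by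
  obtain ⟨h1, h2⟩ := hW
  have : 0 < (W 0).im := by
    by_contra! h
    nlinarith [sq_nonneg (W 1).im, sq_nonneg (W 2).im]
  refine ⟨by simpa using this, ?_⟩
  simpa [mul_comm] using h2

theorem shear_mem_lightTube (x y : ℤ) {W : Fin 4 → ℂ} (hW : W ∈ lightTube) :
    shear x y W ∈ lightTube := by
  obtain ⟨h1, h2⟩ := hW
  refine ⟨by simpa [shear] using h1, ?_⟩
  simp only [shear, Matrix.cons_val, ← Complex.ofReal_intCast]
  simp only [add_im, mul_im, mul_re, ofReal_re, ofReal_im, re_ofNat, im_ofNat, pow_two, add_re]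
  nlinarith

theorem eventually_add_mem_lightTube {W : Fin 4 → ℂ} (hW : 0 < (W 3).im) :
    ∀ᶠ t : ℝ in Filter.atTop, W + ![t * I, 0, 0, 0] ∈ lightTube := by
  filter_upwards [Filter.eventually_ge_atTop
    (((W 1).im ^ 2 + (W 2).im ^ 2 + 1) / (W 3).im - (W 0).im)] with t ht
  refine ⟨by simpa using hW, ?_⟩
  have h1 : ((W 1).im ^ 2 + (W 2).im ^ 2 + 1) / (W 3).im ≤ (W 0).im + t := by linarith
  rw [div_le_iff₀ hW] at h1
  simp
  linarith

theorem hasSum_slice_tendsto {A : (Fin 4 → ℤ) → ℂ} {F : (Fin 4 → ℂ) → ℂ} {m₀ : ℤ}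
    (hF : ∀ W ∈ lightTube, HasSum (fourierTerm A W) (F W))
    (hm : ∀ h, A h ≠ 0 → m₀ ≤ h 0) {W : Fin 4 → ℂ} (hW : 0 < (W 3).im) :
    Summable (fourierTerm (fun h => if h 0 = m₀ then A h else 0) W) ∧
    Filter.Tendsto (fun t : ℝ => cexp (2 * Real.pi * m₀ * t) * F (W + ![t * I, 0, 0, 0]))
      Filter.atTop (nhds (∑' h, fourierTerm (fun h => if h 0 = m₀ then A h else 0) W h)) := by
  obtain ⟨t₀, ht₀⟩ := Filter.eventually_atTop.mp (eventually_add_mem_lightTube hW)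
  have hterm : ∀ (t : ℝ) h, cexp (2 * Real.pi * m₀ * t) *
      fourierTerm A (W + ![t * I, 0, 0, 0]) h =
      fourierTerm A W h * (Real.exp (-(2 * Real.pi * (h 0 - m₀) * t)) : ℝ) := by
    intro t h
    rw [fourierTerm_add, mul_left_comm, ← Complex.exp_add]
    congr 1
    push_cast
    congr 1
    simp [Fin.sum_univ_four]
    linear_combination (2 * Real.pi * h 0 * t : ℂ) * I_sq
  have hsum : ∀ t ≥ t₀, HasSum (fun h => fourierTerm A W h *
      (Real.exp (-(2 * Real.pi * (h 0 - m₀) * t)) : ℝ))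
      (cexp (2 * Real.pi * m₀ * t) * F (W + ![t * I, 0, 0, 0])) := by
    intro t ht
    exact ((hF _ (ht₀ t ht)).mul_left _).congr_fun fun h => (hterm t h).symm
  have hbd := (hsum t₀ le_rfl).summable.norm
  have hslice : ∀ h, fourierTerm (fun h => if h 0 = m₀ then A h else 0) W h =
      if h 0 = m₀ then fourierTerm A W h else 0 := by
    intro h
    by_cases hh : h 0 = m₀ <;> simp [fourierTerm, hh]
  constructor
  · refine Summable.of_norm_bounded hbd fun h => ?_
    rw [hslice]
    split_ifs with hh
    · simp [hh]
    · simp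
  · have hlim := tendsto_tsum_of_dominated_convergence (𝓕 := Filter.atTop)
      (f := fun (t : ℝ) h => fourierTerm A W h *
        ((Real.exp (-(2 * Real.pi * (h 0 - m₀) * t)) : ℝ) : ℂ))
      (g := fourierTerm (fun h => if h 0 = m₀ then A h else 0) W) hbd ?_ ?_
    · refine hlim.congr' ?_
      filter_upwards [Filter.eventually_ge_atTop t₀] with t ht using (hsum t ht).tsum_eq
    · intro h
      rw [hslice]
      split_ifs with hh
      · simp [hh]
      · by_cases hA : A h = 0
        · simp [fourierTerm_eq_zero hA]
        · have hlt : (0 : ℝ) < 2 * Real.pi * (h 0 - m₀) := by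
            have h1 : m₀ < h 0 := lt_of_le_of_ne (hm h hA) (Ne.symm hh)
            have h2 : (0 : ℝ) < h 0 - m₀ := by
              rw [sub_pos]
              exact_mod_cast h1
            have := Real.pi_pos
            positivity
          have h3 : Filter.Tendsto (fun t : ℝ => Real.exp (-(2 * Real.pi * (h 0 - m₀) * t)))
              Filter.atTop (nhds 0) :=
            Real.tendsto_exp_neg_atTop_nhds_zero.comp
              (Filter.tendsto_id.const_mul_atTop hlt)
          simpa using (((Complex.continuous_ofReal.tendsto 0).comp h3).const_mul
            (fourierTerm A W h))
    · filter_upwards [Filter.eventually_ge_atTop t₀] with t ht h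
      by_cases hA : A h = 0
      · simp [fourierTerm_eq_zero hA]
      · rw [norm_mul, norm_mul]
        refine mul_le_mul_of_nonneg_left ?_ (norm_nonneg _)
        rw [Complex.norm_real, Complex.norm_real, Real.norm_eq_abs, Real.norm_eq_abs,
          Real.abs_exp, Real.abs_exp, Real.exp_le_exp]
        have h1 : (0 : ℝ) ≤ h 0 - m₀ := by
          rw [sub_nonneg]
          exact_mod_cast hm h hA
        have := Real.pi_pos
        have h2 : 0 ≤ 2 * Real.pi * ((h 0 : ℝ) - m₀) := by positivity
        nlinarith

/-- A generalized Dirichlet series with nonnegative exponents is holomorphic and decays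
exponentially at the cusp. -/
theorem dirichletSeries_holomorphic_and_decay {β : Type*} {c : β → ℂ} {E : β → ℝ} {e : ℝ}
    (he : 0 ≤ e) (hE : ∀ b, c b ≠ 0 → e ≤ E b)
    (hs : ∀ z : ℂ, 0 < z.im → Summable fun b => c b * cexp (2 * Real.pi * I * (E b * z))) :
    DifferentiableOn ℂ (fun z => ∑' b, c b * cexp (2 * Real.pi * I * (E b * z)))
      {z | 0 < z.im} ∧
    ∃ C : ℝ, 0 ≤ C ∧ ∀ z : ℂ, 1 ≤ z.im →
      ‖∑' b, c b * cexp (2 * Real.pi * I * (E b * z))‖ ≤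
        C * Real.exp (-2 * Real.pi * e * z.im) := by
  have hnorm : ∀ b (z : ℂ), ‖c b * cexp (2 * Real.pi * I * (E b * z))‖ =
      ‖c b‖ * Real.exp (-2 * Real.pi * E b * z.im) := by
    intro b z
    rw [norm_mul, Complex.norm_exp]
    congr 2
    simp
    ring
  have hle : ∀ b (y : ℝ) (z : ℂ), y ≤ z.im → ‖c b * cexp (2 * Real.pi * I * (E b * z))‖ ≤
      ‖c b * cexp (2 * Real.pi * I * (E b * (y * I)))‖ *
        Real.exp (-2 * Real.pi * e * (z.im - y)) := by
    intro b y z hyz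
    rw [hnorm, hnorm, mul_assoc ‖c b‖, ← Real.exp_add]
    by_cases hc : c b = 0
    · simp [hc]
    · refine mul_le_mul_of_nonneg_left (Real.exp_le_exp.mpr ?_) (norm_nonneg _)
      have h1 := hE b hc
      have h2 : 0 ≤ 2 * Real.pi * ((E b - e) * (z.im - y)) := by
        have := mul_nonneg (sub_nonneg.mpr h1) (sub_nonneg.mpr hyz)
        have := Real.pi_pos
        positivity
      simp
      linarith
  constructor
  · intro z₀ hz₀
    have hz₀' : 0 < z₀.im := hz₀
    have hopen : IsOpen {z : ℂ | z₀.im / 2 < z.im} := isOpen_lt continuous_const continuous_im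
    have hd : DifferentiableOn ℂ (fun z => ∑' b, c b * cexp (2 * Real.pi * I * (E b * z)))
        {z : ℂ | z₀.im / 2 < z.im} := by
      refine differentiableOn_tsum_of_summable_norm
        (hs ((z₀.im / 2 : ℝ) * I) (by simpa using hz₀')).norm ?_ hopen ?_
      · intro b
        fun_prop
      · intro b z hz
        refine (hle b _ z (le_of_lt hz)).trans (mul_le_of_le_one_right (norm_nonneg _) ?_)
        rw [Real.exp_le_one_iff]
        have h1 : 0 ≤ z.im - z₀.im / 2 := sub_nonneg.mpr (le_of_lt hz)
        have := Real.pi_pos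
        have : 0 ≤ 2 * Real.pi * e * (z.im - z₀.im / 2) := by positivity
        linarith
    exact (hd.differentiableAt (hopen.mem_nhds (by
      change z₀.im / 2 < z₀.im
      linarith))).differentiableWithinAt
  · have h1 := (hs (((1 : ℝ) : ℂ) * I) (by simp)).norm
    refine ⟨(∑' b, ‖c b * cexp (2 * Real.pi * I * (E b * (((1 : ℝ) : ℂ) * I)))‖) *
      Real.exp (2 * Real.pi * e), by positivity, fun z hz => ?_⟩
    refine (tsum_of_norm_bounded (h1.hasSum.mul_right _) fun b => hle b 1 z hz).trans ?_
    rw [mul_assoc (∑' b, _), ← Real.exp_add]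
    refine le_of_eq ?_
    congr 2
    ring

theorem slice_shear {A : (Fin 4 → ℤ) → ℂ} {F : (Fin 4 → ℂ) → ℂ} {m₀ : ℤ}
    (hF : ∀ W ∈ lightTube, HasSum (fourierTerm A W) (F W))
    (hm : ∀ h, A h ≠ 0 → m₀ ≤ h 0) (x y : ℤ)
    (hshear : ∀ W ∈ lightTube, F (shear x y W) = F W) {W : Fin 4 → ℂ} (hW : 0 < (W 3).im) :
    ∑' h, fourierTerm (fun h => if h 0 = m₀ then A h else 0) (shear x y W) h =
      ∑' h, fourierTerm (fun h => if h 0 = m₀ then A h else 0) W h := by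
  have h1 := (hasSum_slice_tendsto hF hm (W := shear x y W) (by simpa [shear] using hW)).2
  refine tendsto_nhds_unique h1 ((hasSum_slice_tendsto hF hm hW).2.congr' ?_)
  filter_upwards [eventually_add_mem_lightTube hW] with t ht
  rw [← hshear _ ht]
  congr 2
  funext i
  fin_cases i <;> simp [shear]
  ring

theorem slice_inversion {A : (Fin 4 → ℤ) → ℂ} {F : (Fin 4 → ℂ) → ℂ} {m₀ k : ℤ}
    (hF : ∀ W ∈ lightTube, HasSum (fourierTerm A W) (F W))
    (hm : ∀ h, A h ≠ 0 → m₀ ≤ h 0)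
    (hinv : ∀ W ∈ lightTube, F (inversion W) = W 3 ^ k * F W) {W : Fin 4 → ℂ}
    (hW : 0 < (W 3).im) :
    ∑' h, fourierTerm (fun h => if h 0 = m₀ then A h else 0) (inversion W) h =
      W 3 ^ k * ∑' h, fourierTerm (fun h => if h 0 = m₀ then A h else 0) W h := by
  have him : 0 < (inversion W 3).im := by
    simp only [inversion, Matrix.cons_val]
    rw [neg_div, one_div, Complex.neg_im, Complex.inv_im]
    have h0 : W 3 ≠ 0 := fun h => by simp [h] at hW
    have := Complex.normSq_pos.mpr h0
    rw [neg_div, neg_neg]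
    positivity
  have h1 := (hasSum_slice_tendsto hF hm him).2
  refine tendsto_nhds_unique h1
    (((hasSum_slice_tendsto hF hm hW).2.const_mul (W 3 ^ k)).congr' ?_)
  filter_upwards [eventually_add_mem_lightTube hW] with t ht
  have h2 : inversion W + ![t * I, 0, 0, 0] = inversion (W + ![t * I, 0, 0, 0]) := by
    funext i
    fin_cases i <;> simp [inversion]
    ring
  rw [h2, hinv _ ht]
  simp
  ring

theorem slice_translate {c : (Fin 4 → ℤ) → ℂ} {m₀ : ℤ} (hc : ∀ h, c h ≠ 0 → h 0 = m₀)
    (W : Fin 4 → ℂ) (r : ℂ) (p q s : ℤ) :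
    ∑' h, fourierTerm c (W + ![r, p, q, s]) h =
      cexp (2 * Real.pi * I * (m₀ * r)) * ∑' h, fourierTerm c W h := by
  rw [← tsum_mul_left]
  refine tsum_congr fun h => ?_
  by_cases h0 : c h = 0
  · simp [fourierTerm_eq_zero h0]
  · rw [fourierTerm_add, mul_comm]
    congr 1
    rw [Complex.exp_eq_exp_iff_exists_int]
    refine ⟨h 1 * p + h 2 * q + h 3 * s, ?_⟩
    simp [Fin.sum_univ_four, hc h h0]
    ring

theorem norm_slice_translate {c : (Fin 4 → ℤ) → ℂ} {m₀ : ℤ} (hc : ∀ h, c h ≠ 0 → h 0 = m₀)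
    (W : Fin 4 → ℂ) (r : ℝ) (p q s : ℤ) :
    ‖∑' h, fourierTerm c (W + ![(r : ℂ), p, q, s]) h‖ = ‖∑' h, fourierTerm c W h‖ := by
  rw [slice_translate hc, norm_mul, Complex.norm_exp]
  simp

/-- The restriction of a four-dimensional point to the section attached to the characteristic
`(l₁, u₁), (l₂, u₂)`. -/
def sectionPoint (l₁ u₁ l₂ u₂ : ℝ) (z : ℂ) : Fin 4 → ℂ :=
  ![(l₁ ^ 2 + l₂ ^ 2) * z, l₁ * z + u₁, l₂ * z + u₂, z]

theorem norm_sectionPoint_add_int {Φ : (Fin 4 → ℂ) → ℂ}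
    (htr : ∀ W (r : ℝ) (p q s : ℤ), ‖Φ (W + ![(r : ℂ), p, q, s])‖ = ‖Φ W‖)
    (hsh : ∀ (x y : ℤ) (W : Fin 4 → ℂ), 0 < (W 3).im → Φ (shear x y W) = Φ W)
    (l₁ u₁ l₂ u₂ : ℝ) (x p y q : ℤ) {z : ℂ} (hz : 0 < z.im) :
    ‖Φ (sectionPoint (l₁ + x) (u₁ + p) (l₂ + y) (u₂ + q) z)‖ =
      ‖Φ (sectionPoint l₁ u₁ l₂ u₂ z)‖ := by
  have h : sectionPoint (l₁ + x) (u₁ + p) (l₂ + y) (u₂ + q) z =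
      shear x y (sectionPoint l₁ u₁ l₂ u₂ z +
        ![((-(2 * x * (u₁ + p)) - 2 * y * (u₂ + q) : ℝ) : ℂ), p, q, (0 : ℤ)]) := by
    funext i
    fin_cases i <;> simp [shear, sectionPoint] <;> ring
  rw [h, hsh _ _ _ (by simpa [sectionPoint] using hz), htr]

theorem norm_sectionPoint_add_one {Φ : (Fin 4 → ℂ) → ℂ}
    (htr : ∀ W (r : ℝ) (p q s : ℤ), ‖Φ (W + ![(r : ℂ), p, q, s])‖ = ‖Φ W‖)
    (l₁ u₁ l₂ u₂ : ℝ) (z : ℂ) :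
    ‖Φ (sectionPoint l₁ u₁ l₂ u₂ (z + 1))‖ =
      ‖Φ (sectionPoint l₁ (u₁ + l₁) l₂ (u₂ + l₂) z)‖ := by
  rw [← htr (sectionPoint l₁ (u₁ + l₁) l₂ (u₂ + l₂) z) (l₁ ^ 2 + l₂ ^ 2) 0 0 1]
  congr 2
  funext i
  fin_cases i <;> simp [sectionPoint] <;> ring

theorem norm_sectionPoint_neg_one_div {Φ : (Fin 4 → ℂ) → ℂ} {k : ℤ}
    (htr : ∀ W (r : ℝ) (p q s : ℤ), ‖Φ (W + ![(r : ℂ), p, q, s])‖ = ‖Φ W‖)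
    (hin : ∀ W : Fin 4 → ℂ, 0 < (W 3).im → Φ (inversion W) = W 3 ^ k * Φ W)
    (l₁ u₁ l₂ u₂ : ℝ) {z : ℂ} (hz : 0 < z.im) :
    ‖Φ (sectionPoint l₁ u₁ l₂ u₂ (-1 / z))‖ =
      ‖z‖ ^ k * ‖Φ (sectionPoint u₁ (-l₁) u₂ (-l₂) z)‖ := by
  have hz0 : z ≠ 0 := fun h => by simp [h] at hz
  have h : sectionPoint l₁ u₁ l₂ u₂ (-1 / z) =
      inversion (sectionPoint u₁ (-l₁) u₂ (-l₂) z +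
        ![((-(2 * (l₁ * u₁ + l₂ * u₂)) : ℝ) : ℂ), (0 : ℤ), (0 : ℤ), (0 : ℤ)]) := by
    funext i
    fin_cases i <;> simp [inversion, sectionPoint] <;> field_simp <;> ring
  rw [h, hin _ (by simpa [sectionPoint] using hz), norm_mul, htr, norm_zpow]
  simp [sectionPoint]

theorem exists_int_div_eq_val_div_add {N : ℕ} [NeZero N] (a : ℤ) :
    ∃ x : ℤ, (a : ℝ) / N = (((a : ZMod N).val : ℝ)) / N + x := by
  refine ⟨a / N, ?_⟩
  have hN : (N : ℝ) ≠ 0 := Nat.cast_ne_zero.mpr (NeZero.ne N)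
  have h1 : ((a : ZMod N).val : ℤ) = a % N := ZMod.val_intCast a
  have h2 : ((a : ZMod N).val : ℝ) = ((a % N : ℤ) : ℝ) := by exact_mod_cast h1
  have h3 : ((a % N : ℤ) : ℝ) + N * ((a / N : ℤ) : ℝ) = a := by
    exact_mod_cast Int.emod_add_mul_ediv a N
  rw [h2, ← h3]
  field_simp

/-- The rotation of characteristics induced by the inversion. -/
def rotatePair (R : Type*) [AddGroup R] : Equiv.Perm (R × R) where
  toFun x := (x.2, -x.1)
  invFun x := (-x.2, x.1)
  left_inv x := by simp
  right_inv x := by simp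

/-- The shift of characteristics induced by the unit translation. -/
def shiftPair (R : Type*) [AddGroup R] : Equiv.Perm (R × R) where
  toFun x := (x.1, x.2 + x.1)
  invFun x := (x.1, x.2 - x.1)
  left_inv x := by simp
  right_inv x := by simp

/-- The section attached to a characteristic of denominator `N`. -/
def torsionPoint {N : ℕ} (X : (ZMod N × ZMod N) × ZMod N × ZMod N) (z : ℂ) : Fin 4 → ℂ :=
  sectionPoint (X.1.1.val / N) (X.1.2.val / N) (X.2.1.val / N) (X.2.2.val / N) z

theorem norm_sectionPoint_int_div {Φ : (Fin 4 → ℂ) → ℂ} {N : ℕ} [NeZero N]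
    (htr : ∀ W (r : ℝ) (p q s : ℤ), ‖Φ (W + ![(r : ℂ), p, q, s])‖ = ‖Φ W‖)
    (hsh : ∀ (x y : ℤ) (W : Fin 4 → ℂ), 0 < (W 3).im → Φ (shear x y W) = Φ W)
    (a b c d : ℤ) {z : ℂ} (hz : 0 < z.im) :
    ‖Φ (sectionPoint (a / N) (b / N) (c / N) (d / N) z)‖ =
      ‖Φ (torsionPoint (((a : ZMod N), (b : ZMod N)), ((c : ZMod N), (d : ZMod N))) z)‖ := by
  obtain ⟨x, hx⟩ := exists_int_div_eq_val_div_add (N := N) a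
  obtain ⟨p, hp⟩ := exists_int_div_eq_val_div_add (N := N) b
  obtain ⟨y, hy⟩ := exists_int_div_eq_val_div_add (N := N) c
  obtain ⟨q, hq⟩ := exists_int_div_eq_val_div_add (N := N) d
  rw [hx, hp, hy, hq, norm_sectionPoint_add_int htr hsh _ _ _ _ x p y q hz]
  rfl

/-- The valence inequality for the restrictions of a slice to torsion sections. -/
theorem torsion_valence {Φ : (Fin 4 → ℂ) → ℂ} {k m₀ n₀ : ℤ} {N : ℕ} [Fact N.Prime]
    (hm₀ : 0 ≤ m₀)
    (htr : ∀ W (r : ℝ) (p q s : ℤ), ‖Φ (W + ![(r : ℂ), p, q, s])‖ = ‖Φ W‖)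
    (hsh : ∀ (x y : ℤ) (W : Fin 4 → ℂ), 0 < (W 3).im → Φ (shear x y W) = Φ W)
    (hin : ∀ W : Fin 4 → ℂ, 0 < (W 3).im → Φ (inversion W) = W 3 ^ k * Φ W)
    (hd : ∀ l₁ u₁ l₂ u₂ : ℝ, l₁ ∈ Set.Icc 0 1 → l₂ ∈ Set.Icc 0 1 →
      DifferentiableOn ℂ (fun z => Φ (sectionPoint l₁ u₁ l₂ u₂ z)) {z | 0 < z.im} ∧
      ∃ C : ℝ, 0 ≤ C ∧ ∀ z : ℂ, 1 ≤ z.im → ‖Φ (sectionPoint l₁ u₁ l₂ u₂ z)‖ ≤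
        C * Real.exp (-2 * Real.pi *
          (n₀ - m₀ * (l₁ * (1 - l₁) + l₂ * (1 - l₂))) * z.im))
    (hne : ∃ (X : (ZMod N × ZMod N) × ZMod N × ZMod N) (z : ℂ), 0 < z.im ∧
      Φ (torsionPoint X z) ≠ 0) : 12 * n₀ - 4 * m₀ ≤ k := by
  classical
  have hN : N ≠ 0 := NeZero.ne N
  have hN0 : (0 : ℝ) < N := Nat.cast_pos.mpr (Nat.pos_of_ne_zero hN)
  let s : Equiv.Perm ((ZMod N × ZMod N) × ZMod N × ZMod N) :=
    (rotatePair (ZMod N)).prodCongr (rotatePair (ZMod N))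
  let t : Equiv.Perm ((ZMod N × ZMod N) × ZMod N × ZMod N) :=
    (shiftPair (ZMod N)).prodCongr (shiftPair (ZMod N))
  have hT : ∀ X (z : ℂ), 0 < z.im →
      ‖Φ (torsionPoint X (z + 1))‖ = ‖Φ (torsionPoint (t X) z)‖ := by
    intro X z hz
    have h := norm_sectionPoint_int_div (N := N) htr hsh X.1.1.val (X.1.2.val + X.1.1.val)
      X.2.1.val (X.2.2.val + X.2.1.val) hz
    rw [torsionPoint, norm_sectionPoint_add_one htr]
    simpa [t, shiftPair, Prod.map, add_div] using h
  have hS : ∀ X (z : ℂ), 0 < z.im →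
      ‖Φ (torsionPoint X (-1 / z))‖ = ‖z‖ ^ k * ‖Φ (torsionPoint (s X) z)‖ := by
    intro X z hz
    have h := norm_sectionPoint_int_div (N := N) htr hsh X.1.2.val (-X.1.1.val)
      X.2.2.val (-X.2.1.val) hz
    rw [torsionPoint, norm_sectionPoint_neg_one_div htr hin _ _ _ _ hz]
    congr 1
    simpa [s, rotatePair, Prod.map, neg_div] using h
  let O : Finset ((ZMod N × ZMod N) × ZMod N × ZMod N) :=
    Finset.univ.filter fun X => ∃ z : ℂ, 0 < z.im ∧ Φ (torsionPoint X z) ≠ 0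
  have hO : ∀ X, X ∈ O ↔ ∃ z : ℂ, 0 < z.im ∧ Φ (torsionPoint X z) ≠ 0 := by simp [O]
  have him : ∀ z : ℂ, 0 < z.im → 0 < (-1 / z).im := by
    intro z hz
    have h0 : z ≠ 0 := fun h => by simp [h] at hz
    have := Complex.normSq_pos.mpr h0
    rw [neg_div, one_div, Complex.neg_im, Complex.inv_im, neg_div, neg_neg]
    positivity
  have ht : ∀ X, t X ∈ O ↔ X ∈ O := by
    intro X
    rw [hO, hO]
    constructor
    · rintro ⟨z, hz, h⟩
      refine ⟨z + 1, by simpa using hz, ?_⟩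
      rwa [← norm_ne_zero_iff, hT X z hz, norm_ne_zero_iff]
    · rintro ⟨z, hz, h⟩
      refine ⟨z - 1, by simpa using hz, ?_⟩
      rwa [← norm_ne_zero_iff, ← hT X _ (by simpa using hz), sub_add_cancel, norm_ne_zero_iff]
  have hs : ∀ X, s X ∈ O ↔ X ∈ O := by
    intro X
    rw [hO, hO]
    constructor
    · rintro ⟨z, hz, h⟩
      refine ⟨-1 / z, him z hz, ?_⟩
      have hz0 : z ≠ 0 := fun h => by simp [h] at hz
      rw [← norm_ne_zero_iff, hS X z hz]
      exact mul_ne_zero (zpow_ne_zero _ (norm_ne_zero_iff.mpr hz0)) (norm_ne_zero_iff.mpr h)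
    · rintro ⟨z, hz, h⟩
      refine ⟨-1 / z, him z hz, ?_⟩
      have hz0 : z ≠ 0 := fun h => by simp [h] at hz
      have h1 := hS X _ (him z hz)
      rw [show -1 / (-1 / z) = z by field_simp] at h1
      intro h2
      rw [h2, norm_zero, mul_zero, norm_eq_zero] at h1
      exact h h1
  have hval : ∀ a : ZMod N, ((a.val : ℝ) / N) ∈ Set.Icc (0 : ℝ) 1 := by
    intro a
    refine ⟨by positivity, ?_⟩
    rw [div_le_one hN0]
    exact_mod_cast (ZMod.val_lt a).le
  let e : (ZMod N × ZMod N) × ZMod N × ZMod N → ℝ := fun X =>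
    n₀ - m₀ * ((X.1.1.val : ℝ) / N * (1 - (X.1.1.val : ℝ) / N) +
      (X.2.1.val : ℝ) / N * (1 - (X.2.1.val : ℝ) / N))
  have hmain := valence_inequality O (fun X z => Φ (torsionPoint X z)) s t hs ht k e
    (fun X _ => (hd _ _ _ _ (hval _) (hval _)).1) (fun X _ => hT X) (fun X _ => hS X)
    (fun X _ => (hd _ _ _ _ (hval _) (hval _)).2) (fun X hX => (hO X).mp hX)
  have hB1 := sum_bernoulli_two_nonneg O s t hs ht Prod.fst (fun _ => rfl) (fun _ => rfl)
  have hB2 := sum_bernoulli_two_nonneg O s t hs ht Prod.snd (fun _ => rfl) (fun _ => rfl)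
  have hsum : ∑ X ∈ O, e X = O.card * (n₀ - m₀ / 3 : ℝ) + m₀ *
      (∑ X ∈ O, (((X.1.1.val : ℝ) / N) ^ 2 - (X.1.1.val : ℝ) / N + 1 / 6) +
        ∑ X ∈ O, (((X.2.1.val : ℝ) / N) ^ 2 - (X.2.1.val : ℝ) / N + 1 / 6)) := by
    rw [← Finset.sum_add_distrib, Finset.mul_sum, ← nsmul_eq_mul, ← Finset.sum_const,
      ← Finset.sum_add_distrib]
    refine Finset.sum_congr rfl fun X _ => ?_
    simp only [e]
    ring
  have hm₀' : (0 : ℝ) ≤ m₀ := by exact_mod_cast hm₀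
  have hcard : (0 : ℝ) < O.card := by
    obtain ⟨X, hX⟩ := hne
    exact_mod_cast Finset.card_pos.mpr ⟨X, (hO X).mpr hX⟩
  have h1 : (O.card : ℝ) * (12 * n₀ - 4 * m₀) ≤ O.card * k := by
    have h2 := mul_nonneg hm₀' (add_nonneg hB1 hB2)
    rw [hsum] at hmain
    nlinarith
  have h3 := le_of_mul_le_mul_left h1 hcard
  exact_mod_cast h3

theorem section_holomorphic_and_decay {c : (Fin 4 → ℤ) → ℂ} {m₀ n₀ : ℤ} (hm₀ : 0 ≤ m₀)
    (hmn : m₀ ≤ n₀) (hc : ∀ h, c h ≠ 0 → h 0 = m₀)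
    (hsum : ∀ W : Fin 4 → ℂ, 0 < (W 3).im → Summable (fourierTerm c W))
    (hn : ∀ h, c h ≠ 0 → ∀ x y : ℤ, n₀ ≤ h 3 + h 1 * x + h 2 * y + m₀ * (x ^ 2 + y ^ 2))
    (l₁ u₁ l₂ u₂ : ℝ) (hl₁ : l₁ ∈ Set.Icc 0 1) (hl₂ : l₂ ∈ Set.Icc 0 1) :
    DifferentiableOn ℂ (fun z => ∑' h, fourierTerm c (sectionPoint l₁ u₁ l₂ u₂ z) h)
      {z | 0 < z.im} ∧
    ∃ C : ℝ, 0 ≤ C ∧ ∀ z : ℂ, 1 ≤ z.im →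
      ‖∑' h, fourierTerm c (sectionPoint l₁ u₁ l₂ u₂ z) h‖ ≤
        C * Real.exp (-2 * Real.pi *
          (n₀ - m₀ * (l₁ * (1 - l₁) + l₂ * (1 - l₂))) * z.im) := by
  have hterm : ∀ (z : ℂ) h, fourierTerm c (sectionPoint l₁ u₁ l₂ u₂ z) h =
      c h * cexp (2 * Real.pi * I * (h 1 * u₁ + h 2 * u₂)) * cexp (2 * Real.pi * I *
        (((h 0 * (l₁ ^ 2 + l₂ ^ 2) + h 1 * l₁ + h 2 * l₂ + h 3 : ℝ) : ℂ) * z)) := by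
    intro z h
    rw [fourierTerm, mul_assoc (c h), ← Complex.exp_add]
    congr 2
    simp [sectionPoint, Fin.sum_univ_four]
    ring
  have hm₀' : (0 : ℝ) ≤ m₀ := by exact_mod_cast hm₀
  have hmn' : (m₀ : ℝ) ≤ n₀ := by exact_mod_cast hmn
  obtain ⟨a₁, b₁⟩ := hl₁
  obtain ⟨a₂, b₂⟩ := hl₂
  have key := dirichletSeries_holomorphic_and_decay
    (c := fun h : Fin 4 → ℤ => c h * cexp (2 * Real.pi * I * (h 1 * u₁ + h 2 * u₂)))
    (E := fun h => h 0 * (l₁ ^ 2 + l₂ ^ 2) + h 1 * l₁ + h 2 * l₂ + h 3)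
    (e := n₀ - m₀ * (l₁ * (1 - l₁) + l₂ * (1 - l₂))) ?_ ?_ ?_
  · simpa only [hterm] using key
  · have h1 : l₁ * (1 - l₁) + l₂ * (1 - l₂) ≤ 1 := by
      nlinarith [sq_nonneg (l₁ - 1 / 2), sq_nonneg (l₂ - 1 / 2)]
    nlinarith
  · intro h hh
    have hch := left_ne_zero_of_mul hh
    have h0 : (h 0 : ℝ) = m₀ := by exact_mod_cast hc h hch
    have e00 : (n₀ : ℝ) ≤ h 3 := by exact_mod_cast (by simpa using hn h hch 0 0)
    have e10 : (n₀ : ℝ) ≤ h 3 + h 1 + m₀ := by exact_mod_cast (by simpa using hn h hch 1 0)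
    have e01 : (n₀ : ℝ) ≤ h 3 + h 2 + m₀ := by exact_mod_cast (by simpa using hn h hch 0 1)
    have e11 : (n₀ : ℝ) ≤ h 3 + h 1 + h 2 + m₀ * (1 + 1) := by
      exact_mod_cast (by simpa using hn h hch 1 1)
    have c₁ := sub_nonneg.mpr b₁
    have c₂ := sub_nonneg.mpr b₂
    have f00 := mul_le_mul_of_nonneg_left e00 (mul_nonneg c₁ c₂)
    have f10 := mul_le_mul_of_nonneg_left e10 (mul_nonneg a₁ c₂)
    have f01 := mul_le_mul_of_nonneg_left e01 (mul_nonneg c₁ a₂)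
    have f11 := mul_le_mul_of_nonneg_left e11 (mul_nonneg a₁ a₂)
    rw [h0]
    linarith
  · intro z hz
    exact (hsum (sectionPoint l₁ u₁ l₂ u₂ z) (by simpa [sectionPoint] using hz)).congr
      fun h => hterm z h

theorem exists_prime_fractions_tendsto (u v : ℝ) : ∃ (p : ℕ → ℕ) (i j : ℕ → ℤ),
    (∀ n, (p n).Prime) ∧
    Filter.Tendsto (fun n => (i n : ℝ) / p n) Filter.atTop (nhds u) ∧
    Filter.Tendsto (fun n => (j n : ℝ) / p n) Filter.atTop (nhds v) := by
  choose p hp hprime using Nat.exists_infinite_primes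
  have hlim : Filter.Tendsto (fun n => ((p n : ℝ))⁻¹) Filter.atTop (nhds 0) :=
    tendsto_inv_atTop_zero.comp (tendsto_natCast_atTop_atTop.comp
      (Filter.tendsto_atTop_mono hp Filter.tendsto_id))
  have hfloor : ∀ w : ℝ,
      Filter.Tendsto (fun n => ((⌊w * p n⌋ : ℤ) : ℝ) / p n) Filter.atTop (nhds w) := by
    intro w
    have h1 : Filter.Tendsto (fun n => w - ((p n : ℝ))⁻¹) Filter.atTop (nhds w) := by
      simpa using hlim.const_sub w
    refine tendsto_of_tendsto_of_tendsto_of_le_of_le h1 tendsto_const_nhds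
      (fun n => ?_) (fun n => ?_)
    · have h0 : (0 : ℝ) < p n := by exact_mod_cast (hprime n).pos
      have := Int.lt_floor_add_one (w * p n)
      simp only
      rw [le_div_iff₀ h0, sub_mul, inv_mul_cancel₀ h0.ne']
      linarith
    · have h0 : (0 : ℝ) < p n := by exact_mod_cast (hprime n).pos
      simp only
      rw [div_le_iff₀ h0]
      exact Int.floor_le _
  exact ⟨p, _, _, hprime, hfloor u, hfloor v⟩

/-- A nonzero slice is nonzero on some section with characteristic of prime denominator. -/
theorem exists_torsionPoint_ne_zero {c : (Fin 4 → ℤ) → ℂ} {m₀ : ℤ} (hc0 : c ≠ 0)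
    (hc : ∀ h, c h ≠ 0 → h 0 = m₀)
    (hsum : ∀ W : Fin 4 → ℂ, 0 < (W 3).im → Summable (fourierTerm c W))
    (hsh : ∀ (x y : ℤ) (W : Fin 4 → ℂ), 0 < (W 3).im →
      ∑' h, fourierTerm c (shear x y W) h = ∑' h, fourierTerm c W h) :
    ∃ N : ℕ, N.Prime ∧ ∃ (X : (ZMod N × ZMod N) × ZMod N × ZMod N) (z : ℂ), 0 < z.im ∧
      ∑' h, fourierTerm c (torsionPoint X z) h ≠ 0 := by
  by_contra! hzero
  refine hc0 (eq_zero_of_fourierTerm_hasSum_zero ![I, 0, 0, I] fun x => ?_)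
  have hcont : Continuous fun w : ℝ × ℝ =>
      ∑' h, fourierTerm c (sectionPoint 0 w.1 0 w.2 (I + x 3)) h := by
    refine continuous_tsum (u := fun h => ‖fourierTerm c (sectionPoint 0 0 0 0 (I + x 3)) h‖)
      (fun h => ?_) (hsum _ (by simp [sectionPoint])).norm fun h w => ?_
    · simp only [fourierTerm, sectionPoint, Fin.sum_univ_four, Matrix.cons_val]
      fun_prop
    · refine le_of_eq ?_
      simp [fourierTerm, sectionPoint, Fin.sum_univ_four, Complex.norm_exp]
  have hsec : ∑' h, fourierTerm c (sectionPoint 0 (x 1) 0 (x 2) (I + x 3)) h = 0 := by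
    obtain ⟨p, i, j, hp, hi, hj⟩ := exists_prime_fractions_tendsto (x 1) (x 2)
    have h1 := (hcont.tendsto (x 1, x 2)).comp (hi.prodMk_nhds hj)
    refine tendsto_nhds_unique h1 (tendsto_const_nhds.congr fun n => ?_)
    have : NeZero (p n) := ⟨(hp n).ne_zero⟩
    have h2 := norm_sectionPoint_int_div (Φ := fun W => ∑' h, fourierTerm c W h) (N := p n)
      (norm_slice_translate hc) hsh 0 (i n) 0 (j n) (z := I + x 3) (by simp)
    rw [hzero (p n) (hp n) _ _ (by simp), norm_zero, norm_eq_zero] at h2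
    simpa using h2.symm
  have hW : (![I, 0, 0, I] + fun i => (x i : ℂ)) =
      sectionPoint 0 (x 1) 0 (x 2) (I + x 3) + ![I + x 0, (0 : ℤ), (0 : ℤ), (0 : ℤ)] := by
    funext i
    fin_cases i <;> simp [sectionPoint]
  have h3 := slice_translate hc (sectionPoint 0 (x 1) 0 (x 2) (I + x 3)) (I + x 0) 0 0 0
  rw [hsec, mul_zero, ← hW] at h3
  have h4 := (hsum (![I, 0, 0, I] + fun i => (x i : ℂ)) (by simp)).hasSum
  rwa [h3] at h4

/-- A Fourier series on the light-cone tube with the transformation laws of a modular form of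
weight `k` vanishes if its coefficients with small diagonal indices do. -/
theorem coeff_eq_zero_of_vanishing {k : ℤ} {A : (Fin 4 → ℤ) → ℂ} {F : (Fin 4 → ℂ) → ℂ}
    (hF : ∀ W ∈ lightTube, HasSum (fourierTerm A W) (F W))
    (hsupp : ∀ h, A h ≠ 0 → 0 ≤ h 0 ∧ 0 ≤ h 3)
    (hswap : ∀ W ∈ lightTube, F ![W 3, W 1, -W 2, W 0] = F W)
    (hshear : ∀ (x y : ℤ), ∀ W ∈ lightTube, F (shear x y W) = F W)
    (hinv : ∀ W ∈ lightTube, F (inversion W) = W 3 ^ k * F W)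
    (hvan : ∀ h, 8 * h 0 ≤ k → 8 * h 3 ≤ k → A h = 0) (h : Fin 4 → ℤ) : A h = 0 := by
  by_contra hh
  have hswapA : ∀ h, A (swapIndex h) = A h := by
    refine coeff_comp_eq hF swapIndex (fun W => ![W 3, W 1, -W 2, W 0])
      (fun W => swap_mem_lightTube) (fun h W => ?_) hswap
    simp [swapIndex, Fin.sum_univ_four]
    ring
  have hshearA : ∀ x y h, A (shearIndex x y h) = A h := by
    intro x y
    refine coeff_comp_eq hF (shearIndex x y) (shear x y)
      (fun W => shear_mem_lightTube x y) (fun h W => ?_) (hshear x y)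
    simp [shearIndex, shear, Fin.sum_univ_four]
    ring
  obtain ⟨m₀, ⟨h₁, hh₁, rfl⟩, hm₀⟩ := Int.exists_least_of_bdd
    (P := fun m => ∃ h, A h ≠ 0 ∧ h 0 = m)
    ⟨0, by rintro _ ⟨h, hA, rfl⟩; exact (hsupp h hA).1⟩ ⟨_, h, hh, rfl⟩
  have hm : ∀ h, A h ≠ 0 → h₁ 0 ≤ h 0 := fun h hA => hm₀ _ ⟨h, hA, rfl⟩
  obtain ⟨n₀, ⟨h₂, hh₂, hh₂0, rfl⟩, hn₀⟩ := Int.exists_least_of_bdd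
    (P := fun n => ∃ h, A h ≠ 0 ∧ h 0 = h₁ 0 ∧ h 3 = n)
    ⟨0, by rintro _ ⟨h, hA, _, rfl⟩; exact (hsupp h hA).2⟩ ⟨_, h₁, hh₁, rfl, rfl⟩
  have hmn : h₁ 0 ≤ h₂ 3 := by
    simpa [swapIndex] using hm (swapIndex h₂) (by rwa [hswapA])
  set c : (Fin 4 → ℤ) → ℂ := fun h => if h 0 = h₁ 0 then A h else 0 with hcdef
  have hc : ∀ h, c h ≠ 0 → h 0 = h₁ 0 := by
    intro h hne
    by_contra h0
    simp [hcdef, h0] at hne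
  have hcA : ∀ h, c h ≠ 0 → A h ≠ 0 := by
    intro h hne
    simpa [hcdef, hc h hne] using hne
  have hsum : ∀ W : Fin 4 → ℂ, 0 < (W 3).im → Summable (fourierTerm c W) :=
    fun W hW => (hasSum_slice_tendsto hF hm hW).1
  have hsh : ∀ (x y : ℤ) (W : Fin 4 → ℂ), 0 < (W 3).im →
      ∑' h, fourierTerm c (shear x y W) h = ∑' h, fourierTerm c W h :=
    fun x y W hW => slice_shear hF hm x y (hshear x y) hW
  have hn : ∀ h, c h ≠ 0 → ∀ x y : ℤ,
      h₂ 3 ≤ h 3 + h 1 * x + h 2 * y + h₁ 0 * (x ^ 2 + y ^ 2) := by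
    intro h hne x y
    refine hn₀ _ ⟨shearIndex x y h, by rw [hshearA]; exact hcA h hne, ?_, ?_⟩
    · simpa [shearIndex] using hc h hne
    · simp [shearIndex, hc h hne]
  have hc0 : c ≠ 0 := fun h0 => hh₂ (by simpa [hcdef, hh₂0] using congrFun h0 h₂)
  obtain ⟨N, hN, hne⟩ := exists_torsionPoint_ne_zero hc0 hc hsum hsh
  have : Fact N.Prime := ⟨hN⟩
  have hm0 := (hsupp h₁ hh₁).1
  have hfin := torsion_valence (Φ := fun W => ∑' h, fourierTerm c W h) (k := k) hm0
    (norm_slice_translate hc) hsh (fun W hW => slice_inversion hF hm hinv hW)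
    (section_holomorphic_and_decay hm0 hmn hc hsum hn) hne
  exact hh₂ (hvan h₂ (by lia) (by lia))

/-- The index matrix of integral coordinates `h` in the lattice of `ℚ(√-1)`. -/
def indexMatrix (h : Fin 4 → ℤ) : Matrix (Fin 2) (Fin 2) ℂ :=
  !![(h 0 : ℂ), (h 1 + h 2 * I) / 2; (h 1 - h 2 * I) / 2, (h 3 : ℂ)]

/-- The point of the Hermitian half-space with light-cone coordinates `W`. -/
def pointMatrix (W : Fin 4 → ℂ) : Matrix (Fin 2) (Fin 2) ℂ :=
  !![W 0, W 1 + I * W 2; W 1 - I * W 2, W 3]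

theorem sqrtD_neg_four : sqrtD (-4) = 2 * I := by
  have h : Real.sqrt (-((-4 : ℤ) : ℝ)) = 2 := by
    rw [show (-((-4 : ℤ) : ℝ)) = 2 ^ 2 by norm_num]
    exact Real.sqrt_sq (by norm_num)
  rw [sqrtD, h]
  norm_num

theorem mem_ringInt_neg_four {z : ℂ} : z ∈ ringInt (-4) ↔ ∃ a b : ℤ, z = a + b * I := by
  rw [ringInt, Set.mem_ofPred_eq, sqrtD_neg_four]
  constructor
  · rintro ⟨a, b, rfl⟩
    refine ⟨a - 2 * b, b, ?_⟩
    push_cast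
    ring
  · rintro ⟨a, b, rfl⟩
    refine ⟨a + 2 * b, b, ?_⟩
    push_cast
    ring

theorem conj_half (a b : ℤ) : (starRingEnd ℂ) ((a + b * I) / 2 : ℂ) = (a - b * I) / 2 := by
  rw [map_div₀, Complex.conj_ofNat]
  simp [sub_eq_add_neg]

theorem half_mem_invDiff (a b : ℤ) : ((a + b * I) / 2 : ℂ) ∈ invDiff (-4) := by
  rw [invDiff, Set.mem_ofPred_eq, sqrtD_neg_four, mem_ringInt_neg_four]
  refine ⟨-b, a, ?_⟩
  push_cast
  linear_combination (b : ℂ) * I_sq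

theorem exists_indexMatrix_eq {H : Matrix (Fin 2) (Fin 2) ℂ} (hH : H ∈ LambdaH (-4)) :
    ∃ h, indexMatrix h = H := by
  obtain ⟨hherm, hdiag, hoff⟩ := hH
  obtain ⟨m, hm⟩ := hdiag 0
  obtain ⟨n, hn⟩ := hdiag 1
  obtain ⟨a, b, hab⟩ := mem_ringInt_neg_four.mp (hoff 0 1)
  rw [sqrtD_neg_four] at hab
  have h01 : H 0 1 = (b + (-a) * I) / 2 := by
    linear_combination (-I / 2) * hab + (H 0 1 - b / 2) * I_sq
  have h10 : H 1 0 = (b - (-a) * I) / 2 := by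
    rw [← hherm.apply 1 0, h01]
    simp [sub_eq_add_neg]
  refine ⟨![m, b, -a, n], ?_⟩
  ext i j
  fin_cases i <;> fin_cases j <;> simp [indexMatrix, hm, hn, h01, h10]

theorem indexMatrix_injective : Function.Injective indexMatrix := by
  intro g h hgh
  have e0 := congrFun (congrFun hgh 0) 0
  have e1 := congrFun (congrFun hgh 0) 1
  have e2 := congrFun (congrFun hgh 1) 0
  have e3 := congrFun (congrFun hgh 1) 1
  simp [indexMatrix] at e0 e1 e2 e3
  have f1 : (g 1 : ℂ) = h 1 := by linear_combination (e1 + e2) / 2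
  have f2 : (g 2 : ℂ) = h 2 := by
    linear_combination (-I) * (e1 - e2) / 2 + (g 2 - h 2 : ℂ) * I_sq
  funext i
  fin_cases i
  · exact e0
  · exact_mod_cast f1
  · exact_mod_cast f2
  · exact e3

theorem pointMatrix_mem {W : Fin 4 → ℂ} (hW : W ∈ lightTube) :
    pointMatrix W ∈ HermitianUpperHalfSpace := by
  obtain ⟨h3, hdet⟩ := hW
  have hM : (pointMatrix W - (pointMatrix W)ᴴ).map (fun w => w / (2 * I)) =
      !![((W 0).im : ℂ), (W 1).im + (W 2).im * I; (W 1).im - (W 2).im * I, ((W 3).im : ℂ)] := by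
    have h2I : 2 * I ≠ 0 := by simp
    ext i j
    fin_cases i <;> fin_cases j <;> simp [pointMatrix] <;> rw [div_eq_iff h2I] <;>
      apply Complex.ext <;> simp <;> ring
  rw [HermitianUpperHalfSpace, Set.mem_ofPred_eq, hM]
  refine .of_dotProduct_mulVec_pos ?_ fun x hx => ?_
  · ext i j
    fin_cases i <;> fin_cases j <;> simp [sub_eq_add_neg]
  · generalize (W 0).im = a at *
    generalize (W 1).im = b at *
    generalize (W 2).im = c at *
    generalize (W 3).im = d at *
    rw [Complex.lt_def]
    have hx' : x 0 ≠ 0 ∨ x 1 ≠ 0 := by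
      by_contra! h0
      exact hx (by funext i; fin_cases i <;> simp [h0])
    simp [Matrix.mulVec, dotProduct, Fin.sum_univ_two]
    constructor
    · have hpos : 0 < (d * (x 1).re + b * (x 0).re + c * (x 0).im) ^ 2 +
          (d * (x 1).im + b * (x 0).im - c * (x 0).re) ^ 2 +
          (a * d - (b ^ 2 + c ^ 2)) * ((x 0).re ^ 2 + (x 0).im ^ 2) := by
        by_cases h0 : x 0 = 0
        · have h1 := Complex.normSq_pos.mpr (hx'.resolve_left (not_not.mpr h0))
          rw [Complex.normSq_apply] at h1
          have := mul_pos (mul_pos h3 h3) h1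
          simp [h0]
          linarith
        · have h1 := Complex.normSq_pos.mpr h0
          rw [Complex.normSq_apply] at h1
          have := mul_pos (sub_pos.mpr hdet) h1
          nlinarith [sq_nonneg (d * (x 1).re + b * (x 0).re + c * (x 0).im),
            sq_nonneg (d * (x 1).im + b * (x 0).im - c * (x 0).re)]
      refine pos_of_mul_pos_right (a := d) (hpos.trans_eq ?_) h3.le
      ring
    · ring

theorem indexMatrix_mul_pointMatrix_trace (h : Fin 4 → ℤ) (W : Fin 4 → ℂ) :
    (indexMatrix h * pointMatrix W).trace = ∑ i, (h i : ℂ) * W i := by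
  simp [indexMatrix, pointMatrix, Matrix.trace, Fin.sum_univ_four, Fin.sum_univ_two]
  linear_combination (-h 2 * W 2 : ℂ) * I_sq

theorem hasSum_fourierTerm_coeff {k : ℤ} (f : HermitianModularForm (-4) k) {W : Fin 4 → ℂ}
    (hW : W ∈ lightTube) :
    HasSum (fourierTerm (fun h => f.coeff (indexMatrix h)) W) (f.toFun (pointMatrix W)) := by
  have h1 := f.expansion _ (pointMatrix_mem hW)
  have h2 := (hasSum_subtype_iff_of_support_subset (f := fun H => f.coeff H *
    cexp (2 * Real.pi * I * (H * pointMatrix W).trace)) (s := HermLattice (-4))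
    fun H hH => f.coeff_supported H (left_ne_zero_of_mul hH)).mp h1
  rw [← indexMatrix_injective.hasSum_iff] at h2
  · refine h2.congr_fun fun h => ?_
    simp [fourierTerm, indexMatrix_mul_pointMatrix_trace]
  · intro H hH
    by_contra h0
    exact hH (exists_indexMatrix_eq (f.coeff_supported H (left_ne_zero_of_mul h0)).1)

theorem indexMatrix_posSemidef {h : Fin 4 → ℤ} (hh : (indexMatrix h).PosSemidef) :
    0 ≤ h 0 ∧ 0 ≤ h 3 ∧ normSq ((h 1 + h 2 * I) / 2) ≤ (h 0 : ℝ) * h 3 := by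
  have h0 := hh.diag_nonneg (i := 0)
  have h3 := hh.diag_nonneg (i := 1)
  have hdet := hh.det_nonneg
  simp [indexMatrix, Matrix.det_fin_two] at h0 h3 hdet
  refine ⟨by exact_mod_cast h0, by exact_mod_cast h3, ?_⟩
  have hnorm : ((h 1 + h 2 * I) / 2 * ((h 1 - h 2 * I) / 2) : ℂ) =
      (normSq ((h 1 + h 2 * I) / 2) : ℝ) := by
    rw [← Complex.mul_conj, conj_half]
  rw [hnorm] at hdet
  exact_mod_cast hdet

theorem toFun_levi {k : ℤ} (f : HermitianModularForm (-4) k) {U V : Matrix (Fin 2) (Fin 2) ℂ}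
    (hU : ∀ i j, U i j ∈ ringInt (-4)) (hV : ∀ i j, V i j ∈ ringInt (-4)) (hUV : Uᴴ * V = 1)
    {Z : Matrix (Fin 2) (Fin 2) ℂ} (hZ : Z ∈ HermitianUpperHalfSpace) :
    f.toFun (U * Z * Uᴴ) = (U.det * V.det) ^ (k / 2) * V.det ^ k * f.toFun Z := by
  have hVU : Vᴴ * U = 1 := by
    have := congrArg Matrix.conjTranspose hUV
    simpa using this
  have h0 : (0 : ℂ) ∈ ringInt (-4) := mem_ringInt_neg_four.mpr ⟨0, 0, by simp⟩
  have hM : fromBlocks U 0 0 V ∈ HermitianModularGroup (-4) := by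
    constructor
    · rintro (i | i) (j | j)
      · exact hU i j
      · exact h0
      · exact h0
      · exact hV i j
    · rw [J2, fromBlocks_conjTranspose, fromBlocks_multiply, fromBlocks_multiply]
      simp [hUV, hVU]
  have h := f.transform _ hM Z hZ
  have hinv : V⁻¹ = Uᴴ := Matrix.inv_eq_left_inv hUV
  simpa [matAct, nuChar, hinv, det_fromBlocks_zero₂₁] using h

theorem toFun_swap {k : ℤ} (hk : Even k) (f : HermitianModularForm (-4) k) {W : Fin 4 → ℂ}
    (hW : W ∈ lightTube) :
    f.toFun (pointMatrix ![W 3, W 1, -W 2, W 0]) = f.toFun (pointMatrix W) := by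
  have hU : ∀ i j, (!![0, 1; 1, 0] : Matrix (Fin 2) (Fin 2) ℂ) i j ∈ ringInt (-4) := by
    intro i j
    rw [mem_ringInt_neg_four]
    fin_cases i <;> fin_cases j
    · exact ⟨0, 0, by simp⟩
    · exact ⟨1, 0, by simp⟩
    · exact ⟨1, 0, by simp⟩
    · exact ⟨0, 0, by simp⟩
  have hUU : (!![0, 1; 1, 0] : Matrix (Fin 2) (Fin 2) ℂ)ᴴ * !![0, 1; 1, 0] = 1 := by
    ext i j
    fin_cases i <;> fin_cases j <;> simp [Matrix.mul_apply, Fin.sum_univ_two]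
  have h := toFun_levi f hU hU hUU (pointMatrix_mem hW)
  rw [show (!![0, 1; 1, 0] : Matrix (Fin 2) (Fin 2) ℂ).det = -1 by simp [det_fin_two],
    hk.neg_one_zpow] at h
  simp only [neg_mul_neg, mul_one, _root_.one_zpow, one_mul] at h
  rw [← h]
  congr 1
  ext i j
  fin_cases i <;> fin_cases j <;>
    simp [pointMatrix, Matrix.mul_apply, Fin.sum_univ_two, sub_eq_add_neg]

theorem toFun_shear {k : ℤ} (f : HermitianModularForm (-4) k) (x y : ℤ) {W : Fin 4 → ℂ}
    (hW : W ∈ lightTube) :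
    f.toFun (pointMatrix (shear x y W)) = f.toFun (pointMatrix W) := by
  have hU : ∀ i j, (!![1, (x + y * I : ℂ); 0, 1] : Matrix (Fin 2) (Fin 2) ℂ) i j ∈
      ringInt (-4) := by
    intro i j
    rw [mem_ringInt_neg_four]
    fin_cases i <;> fin_cases j
    · exact ⟨1, 0, by simp⟩
    · exact ⟨x, y, by simp⟩
    · exact ⟨0, 0, by simp⟩
    · exact ⟨1, 0, by simp⟩
  have hV : ∀ i j, (!![1, 0; -(x - y * I : ℂ), 1] : Matrix (Fin 2) (Fin 2) ℂ) i j ∈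
      ringInt (-4) := by
    intro i j
    rw [mem_ringInt_neg_four]
    fin_cases i <;> fin_cases j
    · exact ⟨1, 0, by simp⟩
    · exact ⟨0, 0, by simp⟩
    · exact ⟨-x, y, by simp; ring⟩
    · exact ⟨1, 0, by simp⟩
  have hUV : (!![1, (x + y * I : ℂ); 0, 1] : Matrix (Fin 2) (Fin 2) ℂ)ᴴ *
      !![1, 0; -(x - y * I : ℂ), 1] = 1 := by
    ext i j
    fin_cases i <;> fin_cases j <;> simp [Matrix.mul_apply, Fin.sum_univ_two]
    ring
  have h := toFun_levi f hU hV hUV (pointMatrix_mem hW)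
  simp only [det_fin_two_of, mul_zero, sub_zero, zero_mul, mul_one, _root_.one_zpow,
    one_mul] at h
  rw [← h]
  congr 1
  ext i j
  fin_cases i <;> fin_cases j <;>
    simp [pointMatrix, shear, Matrix.mul_apply, Fin.sum_univ_two]
  · linear_combination (2 * W 2 * y + y ^ 2 * W 3 : ℂ) * I_sq
  · ring
  · ring

theorem toFun_inversion {k : ℤ} (f : HermitianModularForm (-4) k) {W : Fin 4 → ℂ}
    (hW : W ∈ lightTube) :
    f.toFun (pointMatrix (inversion W)) = W 3 ^ k * f.toFun (pointMatrix W) := by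
  have h3 : W 3 ≠ 0 := fun h => by simpa [h] using hW.1
  let M : Matrix (Fin 2 ⊕ Fin 2) (Fin 2 ⊕ Fin 2) ℂ :=
    fromBlocks !![1, 0; 0, 0] !![0, 0; 0, -1] !![0, 0; 0, 1] !![1, 0; 0, 0]
  have hM : M ∈ HermitianModularGroup (-4) := by
    constructor
    · have h0 : (0 : ℂ) ∈ ringInt (-4) := mem_ringInt_neg_four.mpr ⟨0, 0, by simp⟩
      have h1 : (1 : ℂ) ∈ ringInt (-4) := mem_ringInt_neg_four.mpr ⟨1, 0, by simp⟩
      have h2 : (-1 : ℂ) ∈ ringInt (-4) := mem_ringInt_neg_four.mpr ⟨-1, 0, by simp⟩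
      rintro (i | i) (j | j) <;> fin_cases i <;> fin_cases j <;> simp [M, h0, h1, h2]
    · rw [J2, fromBlocks_conjTranspose, fromBlocks_multiply, fromBlocks_multiply]
      congr 1 <;> ext i j <;> fin_cases i <;> fin_cases j <;>
        simp [Matrix.mul_apply, Fin.sum_univ_two]
  have hdet : M.det = 1 := by
    have hsub : M.submatrix finSumFinEquiv.symm finSumFinEquiv.symm =
        !![1, 0, 0, 0; 0, 0, 0, -1; 0, 0, 1, 0; 0, 1, 0, 0] := by
      ext i j
      fin_cases i <;> fin_cases j <;> rfl
    rw [← Matrix.det_submatrix_equiv_self finSumFinEquiv.symm, hsub]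
    simp [det_succ_row_zero, Fin.sum_univ_succ]
  have h := f.transform M hM _ (pointMatrix_mem hW)
  have hden : M.toBlocks₂₁ * pointMatrix W + M.toBlocks₂₂ =
      !![1, 0; W 1 - I * W 2, W 3] := by
    ext i j
    fin_cases i <;> fin_cases j <;>
      simp [M, pointMatrix]
  have hinv : (!![1, 0; W 1 - I * W 2, W 3] : Matrix (Fin 2) (Fin 2) ℂ)⁻¹ =
      !![1, 0; -(W 1 - I * W 2) / W 3, 1 / W 3] := by
    refine Matrix.inv_eq_right_inv ?_
    ext i j
    fin_cases i <;> fin_cases j <;> simp [Matrix.mul_apply, Fin.sum_univ_two, h3]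
    field_simp
    ring
  rw [matAct, hden, hinv, nuChar, if_pos rfl, hdet, det_fin_two_of, _root_.one_zpow] at h
  simp only [one_mul, zero_mul, sub_zero] at h
  rw [← h]
  congr 1
  ext i j
  fin_cases i <;> fin_cases j <;>
    simp [M, pointMatrix, inversion, Matrix.mul_apply, Fin.sum_univ_two]
  · field_simp
    linear_combination (-W 2 ^ 2) * I_sq
  · field_simp
  · field_simp
    ring
  · field_simp

/-- **Vanishing criterion over ℚ(√-1)** (Corollary 1.2 (2), `K = ℚ(√-1)`).
If a symmetric Hermitian modular form of even weight `k` with rational Fourier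
coefficients has `a_f([[m, α], [ᾱ, n]]) = 0` for all `0 ≤ m ≤ (5k+8)/40`,
`0 ≤ n ≤ (15k+4)/120`, `α ∈ D_K⁻¹` with `mn - N(α) ≥ 0`, then `f = 0`. -/
theorem vanishing_criterion_sqrt_neg_one
    (p : ℕ) (hp : Nat.Prime p) (hp5 : 5 ≤ p) (k : ℤ) (hk : Even k)
    (f : HermitianModularForm (-4) k) (hsym : IsSymmetricHMF f)
    (hrat : ∀ H, ∃ q : ℚ, f.coeff H = (q : ℂ))
    (hvan : ∀ (m n : ℤ) (α : ℂ), α ∈ invDiff (-4) →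
      0 ≤ m → 40 * m ≤ 5 * k + 8 → 0 ≤ n → 120 * n ≤ 15 * k + 4 →
      Complex.normSq α ≤ (m : ℝ) * (n : ℝ) →
      f.coeff !![(m : ℂ), α; (starRingEnd ℂ) α, (n : ℂ)] = 0) :
    (∀ Z ∈ HermitianUpperHalfSpace, f.toFun Z = 0) ∧ ∀ H, f.coeff H = 0 := by
  have hzero : ∀ h, f.coeff (indexMatrix h) = 0 := by
    refine coeff_eq_zero_of_vanishing (k := k) (F := fun W => f.toFun (pointMatrix W))
      (fun W hW => hasSum_fourierTerm_coeff f hW) (fun h hh => ?_)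
      (fun W hW => toFun_swap hk f hW) (fun x y W hW => toFun_shear f x y hW)
      (fun W hW => toFun_inversion f hW) (fun h h0 h3 => ?_)
    · obtain ⟨h1, h2, -⟩ := indexMatrix_posSemidef (f.coeff_supported _ hh).2
      exact ⟨h1, h2⟩
    · by_contra hh
      obtain ⟨h1, h2, hnorm⟩ := indexMatrix_posSemidef (f.coeff_supported _ hh).2
      have := hvan (h 0) (h 3) _ (half_mem_invDiff (h 1) (h 2)) h1 (by lia) h2 (by lia) hnorm
      rw [conj_half] at this
      exact hh this
  have hcoeff : ∀ H, f.coeff H = 0 := by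
    intro H
    by_contra hH
    obtain ⟨h, rfl⟩ := exists_indexMatrix_eq (f.coeff_supported H hH).1
    exact hH (hzero h)
  refine ⟨fun Z hZ => ?_, hcoeff⟩
  have h := f.expansion Z hZ
  simp only [hcoeff, zero_mul] at h
  exact h.unique hasSum_zero

end
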